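/- Fix nonnegative integers d and k. Then, up to iterated lattice pyramid constructions and unimodular equivalence, there are only finitely many lattice polytopes whose h*-polynomial has degree d and leading coefficient h*_d = k; that is, there is a finite list of lattice polytopes Q_1, …, Q_m such that every lattice polytope P with h*_P of degree d and h*_d = k is unimodularly equivalent to an iterated lattice pyramid over some Q_j. -/

import Mathlib

open scoped BigOperators Pointwise

noncomputable section

/-- A point of `ℝ^m` with integer coordinates (a lattice point). -/
def IsLatticePoint {m : ℕ} (v : Fin m → ℝ) : Prop := ∀ i, ∃ z : ℤ, v i = (z : ℝ)

/-- `P` is a lattice polytope in `ℝ^m`: the convex hull of a nonempty finite set of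
lattice points. -/
def IsLatticePolytope {m : ℕ} (P : Set (Fin m → ℝ)) : Prop :=
  ∃ V : Finset (Fin m → ℝ), V.Nonempty ∧ (∀ v ∈ V, IsLatticePoint v) ∧
    P = convexHull ℝ (V : Set (Fin m → ℝ))

/-- The number of lattice points contained in a subset of `ℝ^m`. -/
def latticePointCount {m : ℕ} (A : Set (Fin m → ℝ)) : ℕ :=
  Set.ncard {z : Fin m → ℤ | (fun i => (z i : ℝ)) ∈ A}

/-- `h` is the `h^*`-polynomial of the full-dimensional lattice polytope `P ⊆ ℝ^n`:
its coefficients are nonnegative, it has degree at most `n`, and the Ehrhart counting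
function of `P` is given by `|mP ∩ ℤ^n| = ∑_i h_i * C(n + m - i, n)`, which is
equivalent to `∑_m |mP ∩ ℤ^n| t^m = h(t)/(1-t)^{n+1}`. -/
def IsHStarPoly {n : ℕ} (P : Set (Fin n → ℝ)) (h : Polynomial ℤ) : Prop :=
  h.natDegree ≤ n ∧ (∀ i, 0 ≤ h.coeff i) ∧
    ∀ m : ℕ, (latticePointCount ((m : ℝ) • P) : ℤ) =
      ∑ i ∈ Finset.range (n + 1), h.coeff i * ((n + m - i).choose n : ℤ)

/-- The normalized volume of a (full-dimensional) polytope in `ℝ^m`: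
`m!` times its Euclidean volume. -/
def normVol {m : ℕ} (P : Set (Fin m → ℝ)) : ℝ :=
  (Nat.factorial m : ℝ) * (MeasureTheory.volume P).toReal

/-- The point of `ℝ^s` over which the `j`-th summand of a Cayley sum sits:
`0` for `j = 0`, and the standard basis vector `e_j` for `j = 1, …, s`. -/
def cayleyVertex (s : ℕ) (j : Fin (s + 1)) : Fin s → ℝ :=
  fun i => if (i : ℕ) + 1 = (j : ℕ) then 1 else 0

/-- The Cayley sum `P_0 * ⋯ * P_s ⊆ ℝ^q × ℝ^s` of polytopes `P_0, …, P_s ⊆ ℝ^q`: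
the convex hull of `(P_0 × {0}) ∪ (P_1 × {e_1}) ∪ ⋯ ∪ (P_s × {e_s})`. -/
def CayleySum {q s : ℕ} (Ps : Fin (s + 1) → Set (Fin q → ℝ)) :
    Set ((Fin q → ℝ) × (Fin s → ℝ)) :=
  convexHull ℝ (⋃ j : Fin (s + 1), (fun p => (p, cayleyVertex s j)) '' Ps j)

/-- A lattice point of `ℝ^q × ℝ^s`. -/
def IsLatticePointPair {q s : ℕ} (v : (Fin q → ℝ) × (Fin s → ℝ)) : Prop :=
  IsLatticePoint v.1 ∧ IsLatticePoint v.2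

/-- An affine isomorphism `ℝ^n ≅ ℝ^q × ℝ^s` is a `ℤ`-affine linear change of coordinates
if it identifies the lattice `ℤ^n` with the lattice `ℤ^q × ℤ^s`. -/
def IsLatticeEquiv {n q s : ℕ} (T : (Fin n → ℝ) ≃ᵃ[ℝ] (Fin q → ℝ) × (Fin s → ℝ)) : Prop :=
  ∀ v : Fin n → ℝ, IsLatticePoint v ↔ IsLatticePointPair (T v)


/-- The lattice pyramid over `A ⊆ ℝ^m`: the convex hull of `(A × {0}) ∪ {(0,…,0,1)}`
in `ℝ^{m+1}`. -/
def latticePyramid {m : ℕ} (A : Set (Fin m → ℝ)) : Set (Fin (m + 1) → ℝ) :=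
  convexHull ℝ
    (((fun p => Fin.snoc p (0 : ℝ)) '' A) ∪ {Fin.snoc (0 : Fin m → ℝ) (1 : ℝ)})

/-- The `r`-fold iterated lattice pyramid over `A ⊆ ℝ^m`. -/
def iterLatticePyramid {m : ℕ} : (r : ℕ) → Set (Fin m → ℝ) → Set (Fin (m + r) → ℝ)
  | 0, A => A
  | r + 1, A => latticePyramid (iterLatticePyramid r A)

/-- Transport of a subset of `ℝ^a` along an equality of dimensions `a = b`. -/
def reindexSet {a b : ℕ} (e : a = b) (A : Set (Fin a → ℝ)) : Set (Fin b → ℝ) :=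
  {f | (fun i : Fin a => f (Fin.cast e i)) ∈ A}

/-- Two subsets of `ℝ^a` are unimodularly equivalent if an affine automorphism of `ℝ^a`
restricting to a bijection of the lattice `ℤ^a` maps one onto the other. -/
def UnimodularlyEquivalent {a : ℕ} (P Q : Set (Fin a → ℝ)) : Prop :=
  ∃ T : (Fin a → ℝ) ≃ᵃ[ℝ] (Fin a → ℝ),
    (∀ u, IsLatticePoint u ↔ IsLatticePoint (T u)) ∧ T '' P = Q

theorem exists_simultaneous_approximation (s : ℕ) (η : ℝ) (hη : 0 < η) :
    ∃ B : ℕ, ∀ (ι : Type) [Fintype ι] (l : ι → ℝ), Fintype.card ι ≤ s →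
      ∃ m : ℕ, 1 ≤ m ∧ m ≤ B ∧ ∃ a : ι → ℤ, ∀ i, |m * l i - a i| < η := by
  classical
  obtain ⟨p, hp⟩ := exists_nat_gt (1 / η)
  have hp0 : (0 : ℝ) < p := lt_trans (by positivity) hp
  have hp0' : 0 < p := by exact_mod_cast hp0
  refine ⟨p ^ s, fun ι _ l hs => ?_⟩
  have hfl : ∀ x : ℝ, ⌊p * Int.fract x⌋₊ < p := fun x => by
    rw [Nat.floor_lt (by positivity)]
    nlinarith [Int.fract_lt_one x]
  let f : Fin (p ^ s + 1) → (ι → Fin p) := fun j i => ⟨⌊p * Int.fract (j * l i)⌋₊, hfl _⟩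
  have hcard : Fintype.card (ι → Fin p) < Fintype.card (Fin (p ^ s + 1)) := by
    simp only [Fintype.card_pi, Finset.prod_const, Fintype.card_fin, Finset.card_univ]
    exact Nat.lt_succ_of_le (Nat.pow_le_pow_right hp0' hs)
  obtain ⟨j, j', hne, hf⟩ := Fintype.exists_ne_map_eq_of_card_lt f hcard
  wlog hlt : j < j' generalizing j j'
  · exact this j' j hne.symm hf.symm (lt_of_le_of_ne (not_lt.1 hlt) hne.symm)
  have hlt' : (j : ℕ) < j' := hlt
  refine ⟨j' - j, by omega, by omega, fun i => ⌊j' * l i⌋ - ⌊j * l i⌋, fun i => ?_⟩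
  have h1 : ⌊p * Int.fract (j * l i)⌋₊ = ⌊p * Int.fract (j' * l i)⌋₊ := by
    have := congrFun hf i
    simpa [f] using this
  have e1 := Nat.floor_le (show 0 ≤ p * Int.fract (j * l i) by positivity)
  have e2 := Nat.lt_floor_add_one (p * Int.fract (j * l i))
  have e3 := Nat.floor_le (show 0 ≤ p * Int.fract (j' * l i) by positivity)
  have e4 := Nat.lt_floor_add_one (p * Int.fract (j' * l i))
  rw [← h1] at e3 e4
  have h2 : |p * (Int.fract (j' * l i) - Int.fract (j * l i))| < 1 := by
    rw [abs_lt]; constructor <;> linarith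
  rw [abs_mul, abs_of_pos hp0] at h2
  have h3 : ((j' - j : ℕ) : ℝ) * l i - ((⌊j' * l i⌋ - ⌊j * l i⌋ : ℤ) : ℝ) =
      Int.fract (j' * l i) - Int.fract (j * l i) := by
    rw [Nat.cast_sub hlt'.le, Int.fract, Int.fract]; push_cast; ring
  rw [h3]
  have h4 : 1 < p * η := by rwa [div_lt_iff₀ hη] at hp
  by_contra hcon
  push Not at hcon
  nlinarith

/-- Integers `m ≥ 1` and `a i` such that `x + t • (m • x - ∑ a i)` keeps positive coordinates
for `t ≤ k`. -/
def HasShift {ι : Type} [Fintype ι] (k : ℕ) (l : ι → ℝ) : Prop :=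
  ∃ (m : ℕ) (a : ι → ℤ), ∑ i, (m * l i - a i) = 0 ∧
    (∀ t : ℕ, t ≤ k → ∀ i, 0 < l i + t * (m * l i - a i)) ∧ ∃ i, (m : ℝ) * l i ≠ a i

theorem exists_gap (s k : ℕ) (δ : ℝ) (hδ : 0 < δ) :
    ∃ δ', 0 < δ' ∧ δ' ≤ δ ∧ ∀ (ι : Type) [Fintype ι] (l : ι → ℝ), Fintype.card ι ≤ s →
      (∀ i, 0 < l i) → (∃ a : ℤ, ∑ i, l i = a) → (∀ i, δ ≤ l i ∨ l i < δ') →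
      (∃ i, l i < δ') → HasShift k l := by
  classical
  set η : ℝ := min (δ / (k + 1)) (1 / (s + 1)) with hη
  have hη0 : 0 < η := by positivity
  obtain ⟨B, hB⟩ := exists_simultaneous_approximation s η hη0
  have hη1 : (k + 1) * η ≤ δ := by
    have : η ≤ δ / (k + 1) := min_le_left _ _
    rw [le_div_iff₀ (by positivity)] at this; linarith
  have hη2 : (s + 1) * η ≤ 1 := by
    have : η ≤ 1 / (s + 1) := min_le_right _ _
    rw [le_div_iff₀ (by positivity)] at this; linarith
  have hδ'δ : η / (B + 1) ≤ δ := by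
    refine (div_le_self hη0.le (by linarith [Nat.cast_nonneg (α := ℝ) B])).trans ?_
    nlinarith [Nat.cast_nonneg (α := ℝ) k]
  refine ⟨η / (B + 1), by positivity, hδ'δ, fun ι _ l hs hpos ⟨z, hz⟩ hgap ⟨i₀, hi₀⟩ => ?_⟩
  obtain ⟨m, hm1, hmB, a, ha⟩ := hB ι l hs
  have hm1' : (1 : ℝ) ≤ m := by exact_mod_cast hm1
  have hmB' : (m : ℝ) ≤ B := by exact_mod_cast hmB
  have hsmall : ∀ i, l i < η / (B + 1) → m * l i < η := fun i hi => by
    rw [lt_div_iff₀ (by positivity)] at hi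
    nlinarith [hpos i]
  let a' : ι → ℤ := fun i => if l i < η / (B + 1) then 0 else a i
  have ha' : ∀ i, |m * l i - a' i| < η := fun i => by
    by_cases h : l i < η / (B + 1)
    · have h0 : 0 < m * l i := mul_pos (by linarith) (hpos i)
      simp only [a', if_pos h, Int.cast_zero, sub_zero]
      rw [abs_of_pos h0]
      exact hsmall i h
    · simp only [a', if_neg h]; exact ha i
  refine ⟨m, a', ?_, fun t ht i => ?_, i₀, ?_⟩
  · have hint : ∑ i, (m * l i - a' i) = ((m * z - ∑ i, a' i : ℤ) : ℝ) := by
      rw [Finset.sum_sub_distrib, ← Finset.mul_sum, hz]; push_cast; ring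
    have hlt : |∑ i, (m * l i - a' i)| < 1 := by
      calc |∑ i, (m * l i - a' i)| ≤ ∑ i, |m * l i - a' i| := Finset.abs_sum_le_sum_abs _ _
        _ ≤ ∑ _i : ι, η := Finset.sum_le_sum fun i _ => (ha' i).le
        _ = Fintype.card ι * η := by simp
        _ ≤ s * η := by gcongr
        _ < 1 := by linarith
    rw [hint] at hlt ⊢
    have : |(m * z - ∑ i, a' i : ℤ)| < 1 := by exact_mod_cast hlt
    rw [Int.abs_lt_one_iff.1 this]; simp
  · have ht' : (t : ℝ) ≤ k := by exact_mod_cast ht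
    have ht0 : (0 : ℝ) ≤ t := Nat.cast_nonneg t
    by_cases h : l i < η / (B + 1)
    · have h0 : 0 < m * l i := mul_pos (by linarith) (hpos i)
      simp only [a', if_pos h, Int.cast_zero, sub_zero]
      nlinarith [hpos i, mul_nonneg ht0 h0.le]
    · have h1 : δ ≤ l i := (hgap i).resolve_right h
      have h2 := (abs_lt.1 (ha' i)).1
      nlinarith
  · have h0 : 0 < m * l i₀ := mul_pos (by linarith) (hpos i₀)
    simp only [a', if_pos hi₀, Int.cast_zero]
    exact h0.ne'

theorem exists_coord_lower_bound (s k : ℕ) :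
    ∃ c : ℝ, 0 < c ∧ c ≤ 1 ∧ ∀ (ι : Type) [Fintype ι] (l : ι → ℝ), Fintype.card ι ≤ s →
      (∀ i, 0 < l i) → (∃ a : ℤ, ∑ i, l i = a) → (∀ i, c ≤ l i) ∨ HasShift k l := by
  classical
  have key : ∀ j : ℕ, ∃ c : ℝ, 0 < c ∧ c ≤ 1 ∧ ∀ (ι : Type) [Fintype ι] (l : ι → ℝ),
      Fintype.card ι ≤ s → (∀ i, 0 < l i) → (∃ a : ℤ, ∑ i, l i = a) →
      (∀ i, c ≤ l i) ∨ HasShift k l ∨ j ≤ (Finset.univ.filter fun i => c ≤ l i).card := by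
    intro j
    induction j with
    | zero => exact ⟨1, one_pos, le_rfl, fun ι _ l _ _ _ => Or.inr (Or.inr (Nat.zero_le _))⟩
    | succ j ih =>
      obtain ⟨c, hc0, hc1, hc⟩ := ih
      obtain ⟨c', hc'0, hc'c, hgap⟩ := exists_gap s k c hc0
      refine ⟨c', hc'0, hc'c.trans hc1, fun ι _ l hs hpos hint => ?_⟩
      by_cases hall : ∀ i, c' ≤ l i
      · exact Or.inl hall
      push Not at hall
      right
      by_cases hg : ∀ i, c ≤ l i ∨ l i < c'
      · exact Or.inl (hgap ι l hs hpos hint hg hall)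
      push Not at hg
      obtain ⟨i, hi1, hi2⟩ := hg
      rcases hc ι l hs hpos hint with h | h | h
      · exact absurd (h i) (not_le.2 hi1)
      · exact Or.inl h
      · right
        refine Nat.succ_le_of_lt (lt_of_le_of_lt h (Finset.card_lt_card ?_))
        rw [Finset.ssubset_iff_of_subset]
        · exact ⟨i, by simpa using hi2, by simpa using hi1⟩
        · intro i' hi'
          simp only [Finset.mem_filter, Finset.mem_univ, true_and] at hi' ⊢
          exact hc'c.trans hi'
  obtain ⟨c, hc0, hc1, hc⟩ := key (s + 1)
  refine ⟨c, hc0, hc1, fun ι _ l hs hpos hint => ?_⟩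
  rcases hc ι l hs hpos hint with h | h | h
  · exact Or.inl h
  · exact Or.inr h
  · have := h.trans (Finset.card_le_univ _)
    omega

open Classical in
theorem exists_notMem_half_of_ne_top {H ι : Type*} [AddCommGroup H] (K : ι → AddSubgroup H)
    (U : Finset ι) (hU : ∀ i ∈ U, K i ≠ ⊤) :
    ∃ z, U.card ≤ 2 * (U.filter fun i => z ∉ K i).card := by
  induction U using Finset.strongInduction with
  | H U ih =>
    rcases U.eq_empty_or_nonempty with rfl | ⟨i₀, hi₀⟩
    · exact ⟨0, by simp⟩
    obtain ⟨h, hh⟩ : ∃ h, h ∉ K i₀ := by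
      by_contra! hcon
      exact hU i₀ hi₀ ((AddSubgroup.eq_top_iff' _).2 hcon)
    set U₁ := U.filter fun i => h ∉ K i with hU₁
    set U₂ := U.filter fun i => ¬ h ∉ K i with hU₂
    have hsub : U₂ ⊂ U := Finset.filter_ssubset.2 ⟨i₀, hi₀, by simpa using hh⟩
    obtain ⟨z, hz⟩ := ih U₂ hsub fun i hi => hU i (hsub.1 hi)
    have hcard : U₁.card + U₂.card = U.card := Finset.card_filter_add_card_filter_not _
    have split : ∀ y : H, (U.filter fun i => y ∉ K i).card =
        (U₁.filter fun i => y ∉ K i).card + (U₂.filter fun i => y ∉ K i).card := fun y => by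
      rw [hU₁, hU₂, Finset.filter_filter, Finset.filter_filter,
        ← Finset.card_filter_add_card_filter_not (s := U.filter fun i => y ∉ K i)
          (fun i => h ∉ K i), Finset.filter_filter, Finset.filter_filter]
      congr 2 <;> (ext; simp only [Finset.mem_filter]; tauto)
    have h₂ : (U₂.filter fun i => z + h ∉ K i).card = (U₂.filter fun i => z ∉ K i).card := by
      congr 1
      refine Finset.filter_congr fun i hi => ?_
      have : h ∈ K i := by simpa [hU₂] using (Finset.mem_filter.1 hi).2
      rw [(K i).add_mem_cancel_right this]
    have h₁ : U₁.card ≤ (U₁.filter fun i => z ∉ K i).card +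
        (U₁.filter fun i => z + h ∉ K i).card := by
      rw [← Finset.card_union_add_card_inter]
      refine le_trans (Finset.card_le_card fun i hi => ?_) (Nat.le_add_right _ _)
      simp only [Finset.mem_union, Finset.mem_filter, hi, true_and]
      by_contra! hcon
      exact (Finset.mem_filter.1 hi).2 (((K i).add_mem_cancel_left hcon.1).1 hcon.2)
    rcases le_total (U₁.filter fun i => z ∉ K i).card (U₁.filter fun i => z + h ∉ K i).card
      with hle | hle
    · exact ⟨z + h, by rw [split, h₂]; omega⟩
    · exact ⟨z, by rw [split]; omega⟩

theorem exists_pos_sum_mul_ne_zero {ι : Type*} [Fintype ι] (S : Finset (ι → ℝ))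
    (hS : ∀ c ∈ S, c ≠ 0) : ∃ w : ι → ℝ, (∀ i, 0 < w i) ∧ ∀ c ∈ S, ∑ i, c i * w i ≠ 0 := by
  classical
  induction S using Finset.induction_on with
  | empty => exact ⟨fun _ => 1, fun _ => one_pos, by simp⟩
  | insert c S hc ih =>
    obtain ⟨w, hw, hwS⟩ := ih fun c hc => hS c (Finset.mem_insert_of_mem hc)
    obtain ⟨i, hi⟩ := Function.ne_iff.1 (hS c (Finset.mem_insert_self _ _))
    have hsum : ∀ (c : ι → ℝ) (e : ℝ), ∑ j, c j * (w j + e * (Pi.single i 1 : ι → ℝ) j) =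
        ∑ j, c j * w j + e * c i := fun c e => by
      simp [mul_add, Finset.sum_add_distrib, Pi.single_apply, mul_comm]
    have hev : ∀ᶠ e : ℝ in nhdsWithin 0 (Set.Ioi 0), (0 < e ∧
        ∀ c ∈ S, ∑ j, c j * w j + e * c i ≠ 0) ∧ ∑ j, c j * w j + e * c i ≠ 0 := by
      refine (Filter.Eventually.and self_mem_nhdsWithin ?_).and ?_
      · refine (Filter.eventually_all_finset S).2 fun c hc => ?_
        have : Filter.Tendsto (fun e : ℝ => ∑ j, c j * w j + e * c i) (nhdsWithin 0 (Set.Ioi 0))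
            (nhds (∑ j, c j * w j + 0 * c i)) :=
          Filter.Tendsto.mono_left (Continuous.tendsto (by fun_prop) _) nhdsWithin_le_nhds
        exact this.eventually_ne (by simpa using hwS c hc)
      · by_cases h0 : ∑ j, c j * w j = 0
        · filter_upwards [self_mem_nhdsWithin] with e he
          rw [h0, zero_add]
          exact mul_ne_zero (ne_of_gt he) hi
        · have : Filter.Tendsto (fun e : ℝ => ∑ j, c j * w j + e * c i)
              (nhdsWithin 0 (Set.Ioi 0)) (nhds (∑ j, c j * w j + 0 * c i)) :=
            Filter.Tendsto.mono_left (Continuous.tendsto (by fun_prop) _) nhdsWithin_le_nhds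
          exact this.eventually_ne (by simpa using h0)
    obtain ⟨e, ⟨he, heS⟩, hec⟩ := hev.exists
    refine ⟨fun j => w j + e * (Pi.single i 1 : ι → ℝ) j, fun j => ?_, fun c' hc' => ?_⟩
    · have : 0 ≤ e * (Pi.single i 1 : ι → ℝ) j := by
        by_cases hj : j = i
        · subst hj; simpa using he.le
        · simp [hj]
      simpa using add_pos_of_pos_of_nonneg (hw j) this
    · rw [hsum]
      rcases Finset.mem_insert.1 hc' with rfl | h
      · exact hec
      · exact heS c' h

section Cones

variable {E : Type} [AddCommGroup E] [Module ℝ E]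

/-- The convex cone generated by a finite set. -/
def conicHull (V : Finset E) : Set E :=
  {y | ∃ l : V → ℝ, (∀ i, 0 ≤ l i) ∧ ∑ i, l i • (i : E) = y}

/-- The algebraic interior of the convex cone generated by a finite set. -/
def conicInterior (V : Finset E) : Set E :=
  {y | ∀ p : E, ∃ ε : ℝ, 0 < ε ∧ y - ε • p ∈ conicHull V}

variable {V : Finset E}

theorem zero_mem_conicHull : (0 : E) ∈ conicHull V := ⟨0, by simp, by simp⟩

theorem add_mem_conicHull {y z : E} (hy : y ∈ conicHull V) (hz : z ∈ conicHull V) :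
    y + z ∈ conicHull V := by
  obtain ⟨l, hl, rfl⟩ := hy
  obtain ⟨m, hm, rfl⟩ := hz
  exact ⟨l + m, fun i => add_nonneg (hl i) (hm i), by simp [add_smul, Finset.sum_add_distrib]⟩

theorem smul_mem_conicHull {c : ℝ} (hc : 0 ≤ c) {y : E} (hy : y ∈ conicHull V) :
    c • y ∈ conicHull V := by
  obtain ⟨l, hl, rfl⟩ := hy
  exact ⟨c • l, fun i => mul_nonneg hc (hl i), by simp [mul_smul, Finset.smul_sum]⟩

theorem mem_conicHull_of_mem {v : E} (hv : v ∈ V) : v ∈ conicHull V := by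
  classical
  refine ⟨Pi.single ⟨v, hv⟩ 1, fun i => ?_, ?_⟩
  · by_cases h : i = ⟨v, hv⟩
    · subst h; simp
    · simp [h]
  · rw [Finset.sum_eq_single ⟨v, hv⟩] <;> simp +contextual

theorem sum_smul_mem_conicHull {ι : Type*} (s : Finset ι) (l : ι → ℝ) (f : ι → E)
    (hl : ∀ i ∈ s, 0 ≤ l i) (hf : ∀ i ∈ s, f i ∈ conicHull V) :
    ∑ i ∈ s, l i • f i ∈ conicHull V :=
  Finset.sum_induction _ (· ∈ conicHull V) (fun _ _ => add_mem_conicHull) zero_mem_conicHull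
    fun i hi => smul_mem_conicHull (hl i hi) (hf i hi)

theorem conicInterior_add_mem {y z : E} (hy : y ∈ conicInterior V) (hz : z ∈ conicHull V) :
    y + z ∈ conicInterior V := fun p => by
  obtain ⟨ε, hε, h⟩ := hy p
  exact ⟨ε, hε, by rw [add_sub_right_comm]; exact add_mem_conicHull h hz⟩

theorem smul_mem_conicInterior {c : ℝ} (hc : 0 < c) {y : E} (hy : y ∈ conicInterior V) :
    c • y ∈ conicInterior V := fun p => by
  obtain ⟨ε, hε, h⟩ := hy p
  refine ⟨c * ε, mul_pos hc hε, ?_⟩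
  rw [mul_smul, ← smul_sub]
  exact smul_mem_conicHull hc.le h

theorem mem_conicHull_of_mem_conicInterior {y : E} (hy : y ∈ conicInterior V) :
    y ∈ conicHull V := by
  obtain ⟨ε, hε, h⟩ := hy 0
  simpa using h

theorem mem_conicInterior_of_sub_smul_mem {x y : E} (hx : x ∈ conicInterior V) {ε : ℝ}
    (hε : 0 < ε) (h : y - ε • x ∈ conicHull V) : y ∈ conicInterior V := by
  have := conicInterior_add_mem (smul_mem_conicInterior hε hx) h
  rwa [add_sub_cancel] at this

theorem eventually_sub_mul_pos (a b : ℝ) (h : 0 < a) :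
    ∀ᶠ ε : ℝ in nhdsWithin 0 (Set.Ioi 0), 0 < a - ε * b := by
  have : Filter.Tendsto (fun ε : ℝ => a - ε * b) (nhdsWithin 0 (Set.Ioi 0))
      (nhds (a - 0 * b)) :=
    Filter.Tendsto.mono_left (Continuous.tendsto (by fun_prop) _) nhdsWithin_le_nhds
  exact this.eventually_const_lt (by simpa using h)

theorem exists_pos_forall_sub_mul_pos {ι : Type*} (s : Finset ι) (a b : ι → ℝ)
    (h : ∀ i ∈ s, 0 < a i) : ∃ ε : ℝ, 0 < ε ∧ ∀ i ∈ s, 0 < a i - ε * b i := by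
  have h1 : ∀ᶠ ε : ℝ in nhdsWithin 0 (Set.Ioi 0), 0 < ε ∧ ∀ i ∈ s, 0 < a i - ε * b i :=
    Filter.Eventually.and self_mem_nhdsWithin
      ((Filter.eventually_all_finset s).2 fun i hi => eventually_sub_mul_pos _ _ (h i hi))
  exact h1.exists

theorem mem_conicInterior_of_repr_pos {κ : Type*} [Fintype κ] (b : Module.Basis κ ℝ E)
    (hb : ∀ i, b i ∈ V) {y : E} (hy : ∀ i, 0 < b.repr y i) : y ∈ conicInterior V := fun p => by
  obtain ⟨ε, hε, h⟩ := exists_pos_forall_sub_mul_pos Finset.univ (b.repr y) (b.repr p)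
    fun i _ => hy i
  refine ⟨ε, hε, ?_⟩
  rw [← b.sum_repr (y - ε • p)]
  exact sum_smul_mem_conicHull _ _ _
    (fun i hi => by simpa using (h i hi).le) fun i _ => mem_conicHull_of_mem (hb i)

/-- Carathéodory's theorem for conic combinations, with a linear cost that must not increase. -/
theorem exists_linearIndepOn_support {ι E : Type*} [AddCommGroup E] [Module ℝ E] [Fintype ι]
    (f : ι → E) (w : ι → ℝ)
    (H : ∀ r : ι → ℝ, r ≠ 0 → ∑ i, r i • f i = 0 →
      (∑ i, w i * r i ≤ 0 ∧ ∃ i, r i < 0) ∨ (0 ≤ ∑ i, w i * r i ∧ ∃ i, 0 < r i))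
    (l : ι → ℝ) (hl : ∀ i, 0 ≤ l i) :
    ∃ l' : ι → ℝ, (∀ i, 0 ≤ l' i) ∧ ∑ i, l' i • f i = ∑ i, l i • f i ∧
      ∑ i, w i * l' i ≤ ∑ i, w i * l i ∧ LinearIndepOn ℝ f {i | l' i ≠ 0} := by
  classical
  induction hn : (Finset.univ.filter fun i => l i ≠ 0).card using Nat.strong_induction_on
    generalizing l with
  | _ n ih =>
    by_cases hind : LinearIndepOn ℝ f {i | l i ≠ 0}
    · exact ⟨l, hl, rfl, le_rfl, hind⟩
    obtain ⟨g, hg0, j, hj⟩ := Fintype.not_linearIndependent_iff.1 hind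
    obtain ⟨r, hr0, hrsum, hrsupp, hrw, hrneg⟩ : ∃ r : ι → ℝ, r ≠ 0 ∧ ∑ i, r i • f i = 0 ∧
        (∀ i, l i = 0 → r i = 0) ∧ ∑ i, w i * r i ≤ 0 ∧ ∃ i, r i < 0 := by
      let r : ι → ℝ := fun i => if h : l i ≠ 0 then g ⟨i, h⟩ else 0
      have hr : ∑ i, r i • f i = 0 := by
        rw [← Finset.sum_filter_of_ne (p := fun i => l i ≠ 0) (fun i _ hi h => hi (by simp [r, h])),
          Finset.sum_subtype (p := fun i => i ∈ {i | l i ≠ 0}) _ (by simp), ← hg0]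
        exact Finset.sum_congr rfl fun i _ => by simp [r, show l i ≠ 0 from i.2]
      have hr0 : r ≠ 0 := fun h => hj (by
        have := congrFun h j.1
        simpa [r, show l j.1 ≠ 0 from j.2] using this)
      rcases H r hr0 hr with ⟨h1, h2⟩ | ⟨h1, i, h2⟩
      · exact ⟨r, hr0, hr, fun i hi => by simp [r, hi], h1, h2⟩
      · exact ⟨-r, neg_ne_zero.2 hr0, by simp [hr], fun i hi => by simp [r, hi],
          by simpa using h1, i, by simpa using h2⟩
    obtain ⟨i₀, hi₀, hmin⟩ := Finset.exists_min_image (Finset.univ.filter fun i => r i < 0)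
      (fun i => l i / (-r i)) (by simpa [Finset.filter_nonempty_iff] using hrneg)
    simp only [Finset.mem_filter, Finset.mem_univ, true_and] at hi₀ hmin
    set t := l i₀ / (-r i₀) with ht
    have ht0 : 0 ≤ t := div_nonneg (hl _) (by linarith)
    have hzero : l i₀ + t * r i₀ = 0 := by
      rw [ht, div_neg, neg_mul, div_mul_cancel₀ _ hi₀.ne, add_neg_cancel]
    have hnn : ∀ i, 0 ≤ l i + t * r i := fun i => by
      rcases lt_or_ge (r i) 0 with h | h
      · have := hmin i h
        rw [le_div_iff₀ (by linarith)] at this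
        linarith
      · exact add_nonneg (hl i) (mul_nonneg ht0 h)
    have hlt : (Finset.univ.filter fun i => l i + t * r i ≠ 0).card < n := by
      rw [← hn]
      refine Finset.card_lt_card ((Finset.ssubset_iff_of_subset ?_).2 ⟨i₀, ?_, ?_⟩)
      · intro i
        simp only [Finset.mem_filter, Finset.mem_univ, true_and]
        intro h h0
        exact h (by rw [h0, hrsupp i h0]; ring)
      · simp only [Finset.mem_filter, Finset.mem_univ, true_and]
        intro h0
        exact absurd (hrsupp _ h0) hi₀.ne
      · simp [hzero]
    obtain ⟨l', h1, h2, h3, h4⟩ := ih _ hlt (fun i => l i + t * r i) hnn rfl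
    refine ⟨l', h1, ?_, h3.trans ?_, h4⟩
    · rw [h2]
      simp only [add_smul, mul_smul, Finset.sum_add_distrib, ← Finset.smul_sum, hrsum, smul_zero,
        add_zero]
    · have : ∑ i, w i * (l i + t * r i) = ∑ i, w i * l i + t * ∑ i, w i * r i := by
        rw [Finset.mul_sum, ← Finset.sum_add_distrib]
        exact Finset.sum_congr rfl fun i _ => by ring
      rw [this]
      nlinarith

theorem exists_basis_of_linearIndepOn [FiniteDimensional ℝ E]
    (hspan : Submodule.span ℝ (V : Set E) = ⊤) (A : Set E)
    (hA : A ⊆ V) (hind : LinearIndepOn ℝ id A) :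
    ∃ (W : Finset E) (b : Module.Basis W ℝ E), W ⊆ V ∧ A ⊆ W ∧ ∀ i, b i = i := by
  classical
  have hsub := hind.subset_extend hA
  have hsub' := hind.extend_subset hA
  have hfin : (hind.extend hA).Finite := V.finite_toSet.subset hsub'
  have hco : ∀ x, x ∈ hfin.toFinset ↔ x ∈ hind.extend hA := fun x => by simp
  have htop : ⊤ ≤ Submodule.span ℝ (hind.extend hA) := by
    rw [← hspan]
    exact Submodule.span_le.2 (hind.subset_span_extend hA)
  refine ⟨hfin.toFinset, (Module.Basis.mk (hind.linearIndepOn_extend hA)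
    (by simpa using htop)).reindex (Equiv.subtypeEquivRight fun x => (hco x).symm),
    fun x hx => hsub' ((hco x).1 hx), fun x hx => (hco x).2 (hsub hx), fun i => ?_⟩
  simp

/-- Every conic combination can be rewritten over a basis without increasing its cost. -/
theorem exists_basis_repr_nonneg [FiniteDimensional ℝ E] {ht : E →ₗ[ℝ] ℝ}
    (hht : ∀ v ∈ V, ht v = 1)
    (hspan : Submodule.span ℝ (V : Set E) = ⊤) (w : E → ℝ) (l : V → ℝ) (hl : ∀ i, 0 ≤ l i) :
    ∃ (W : Finset E) (b : Module.Basis W ℝ E), W ⊆ V ∧ (∀ i, b i = i) ∧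
      (∀ i, 0 ≤ b.repr (∑ i, l i • (i : E)) i) ∧
      ∑ i : W, w i * b.repr (∑ i, l i • (i : E)) i ≤ ∑ i : V, w i * l i := by
  classical
  obtain ⟨l', hl', hsum, hcost, hind⟩ := exists_linearIndepOn_support (fun i : V => (i : E))
    (fun i => w i) (fun r hr0 hr => by
      have h0 : ∑ i, r i = 0 := by
        have := congrArg ht hr
        rw [map_sum, map_zero] at this
        rw [← this]
        exact Finset.sum_congr rfl fun i _ => by simp [hht i i.2]
      have hneg : ∃ i, r i < 0 := by
        by_contra! hcon
        exact hr0 (funext fun i => (Finset.sum_eq_zero_iff_of_nonneg fun i _ => hcon i).1 h0 i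
          (Finset.mem_univ i))
      have hpos : ∃ i, 0 < r i := by
        by_contra! hcon
        exact hr0 (funext fun i => (Finset.sum_eq_zero_iff_of_nonpos fun i _ => hcon i).1 h0 i
          (Finset.mem_univ i))
      rcases le_total (∑ i : V, w i * r i) 0 with h | h
      · exact Or.inl ⟨h, hneg⟩
      · exact Or.inr ⟨h, hpos⟩) l hl
  have hind' : LinearIndepOn ℝ id ((fun i : V => (i : E)) '' {i | l' i ≠ 0}) :=
    hind.id_image
  obtain ⟨W, b, hWV, hAW, hb⟩ := exists_basis_of_linearIndepOn hspan _
    (by rintro _ ⟨i, _, rfl⟩; exact i.2) hind'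
  have hconv : ∀ (G : Type) [AddCommGroup G] (F : E → ℝ → G) (_ : ∀ x, F x 0 = 0),
      ∑ i : V, F i (l' i) = ∑ i : W, F i (l' ⟨i, hWV i.2⟩) := by
    intro G _ F hF
    rw [← Finset.sum_image (s := Finset.univ) (g := fun i : W => (⟨i, hWV i.2⟩ : V))
      (f := fun i : V => F i (l' i))]
    · symm
      refine Finset.sum_subset (Finset.subset_univ _) fun i _ hi => ?_
      have : l' i = 0 := by
        by_contra h
        exact hi (Finset.mem_image.2 ⟨⟨i, hAW ⟨i, h, rfl⟩⟩, Finset.mem_univ _, rfl⟩)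
      rw [this, hF]
    · intro i _ j _ h
      exact Subtype.ext (congrArg (fun x : V => (x : E)) h)
  have hrepr : ∀ i : W, b.repr (∑ i, l i • (i : E)) i = l' ⟨i, hWV i.2⟩ := by
    intro i
    rw [← hsum, hconv E (fun x c => c • x) (by simp)]
    have : ∑ i : W, l' ⟨i, hWV i.2⟩ • (i : E) = ∑ i : W, l' ⟨i, hWV i.2⟩ • b i :=
      Finset.sum_congr rfl fun i _ => by rw [hb]
    rw [this, b.repr_sum_self]
  refine ⟨W, b, hWV, hb, fun i => by rw [hrepr]; exact hl' _, ?_⟩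
  simp only [hrepr]
  rw [← hconv ℝ (fun x c => w x * c) (by simp)]
  exact hcost

end Cones

/-- The integers as a subgroup of `ℝ`. -/
abbrev realIntegers : AddSubgroup ℝ := (Int.castAddHom ℝ).range

section Core

variable {E : Type} [AddCommGroup E] [Module ℝ E]

/-- A point `x` of minimal height among the points of `M` in the interior of the cone generated
by `V`, the height being `dim E - d`, together with a bound on the number of such points along
arithmetic progressions. -/
structure IsMinimalInteriorPoint (M : AddSubgroup E) (V : Finset E) (ht : E →ₗ[ℝ] ℝ) (d k : ℕ)
    (x : E) : Prop where
  ht_eq_one : ∀ v ∈ V, ht v = 1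
  mem_of_mem : ∀ v ∈ V, v ∈ M
  span_eq_top : Submodule.span ℝ (V : Set E) = ⊤
  ht_int : ∀ z ∈ M, ht z ∈ realIntegers
  le_ht : ∀ y ∈ M, y ∈ conicInterior V → (Module.finrank ℝ E : ℝ) - d ≤ ht y
  self_mem : x ∈ M
  self_interior : x ∈ conicInterior V
  ht_self : ht x = (Module.finrank ℝ E : ℝ) - d
  eq_zero_of_progression : ∀ z ∈ M, ht z = 0 →
    (∀ t : ℕ, t ≤ k → x + (t : ℝ) • z ∈ conicInterior V) → z = 0

variable {M : AddSubgroup E} {V : Finset E} {ht : E →ₗ[ℝ] ℝ} {d k : ℕ} {x : E}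
  {κ : Type} [Fintype κ] {b : Module.Basis κ ℝ E}

theorem sum_intCast_smul_mem (hbM : ∀ i, b i ∈ M) (a : κ → ℤ) : ∑ i, (a i : ℝ) • b i ∈ M :=
  M.sum_mem fun i _ => by
    rw [Int.cast_smul_eq_zsmul]
    exact M.zsmul_mem (hbM i) _

theorem ht_eq_sum_repr (hb : ∀ i, ht (b i) = 1) (z : E) : ht z = ∑ i, b.repr z i := by
  conv_lhs => rw [← b.sum_repr z]
  rw [map_sum]
  exact Finset.sum_congr rfl fun i _ => by rw [map_smul, hb, smul_eq_mul, mul_one]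

open Classical in
theorem exists_basis_exchange (b : Module.Basis κ ℝ E) (S : Finset κ) (w : κ → E)
    (h0 : ∀ i ∈ S, b.repr (w i) i ≠ 0)
    (h1 : ∀ i ∈ S, ∀ j ∈ S, i ≠ j → b.repr (w i) j = 0) :
    ∃ g : Module.Basis κ ℝ E, (∀ i ∈ S, g i = w i) ∧ (∀ i, i ∉ S → g i = b i) ∧
      ∀ i ∈ S, ∀ z, g.repr z i = (b.repr (w i) i)⁻¹ * b.repr z i := by
  let f : κ → E := fun i => if i ∈ S then w i else b i
  have hf : ∀ i ∈ S, ∀ j, j ≠ i → b.repr (f j) i = 0 := fun i hi j hj => by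
    by_cases hjS : j ∈ S
    · simp only [f, if_pos hjS]; exact h1 j hjS i hi hj
    · simp [f, if_neg hjS, hj]
  have hfi : ∀ i ∈ S, b.repr (f i) i = b.repr (w i) i := fun i hi => by simp [f, hi]
  have hind : LinearIndependent ℝ f := by
    rw [Fintype.linearIndependent_iff]
    intro c hc
    have hS : ∀ i ∈ S, c i = 0 := fun i hi => by
      have := congrArg (fun z => b.repr z i) hc
      simp only [map_sum, map_smul, Finsupp.finsetSum_apply, Finsupp.smul_apply, map_zero,
        Finsupp.zero_apply, smul_eq_mul] at this
      rw [Finset.sum_eq_single i (fun j _ hj => by rw [hf i hi j hj, mul_zero]) (by simp),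
        hfi i hi] at this
      exact (mul_eq_zero.1 this).resolve_right (h0 i hi)
    have hc' : ∑ i, c i • b i = 0 := by
      rw [← hc]
      refine Finset.sum_congr rfl fun i _ => ?_
      by_cases hi : i ∈ S
      · simp [hS i hi]
      · simp [f, hi]
    exact Fintype.linearIndependent_iff.1 b.linearIndependent c hc'
  rcases isEmpty_or_nonempty κ with hκ | hκ
  · exact ⟨b, fun i => isEmptyElim i, fun i => isEmptyElim i, fun i => isEmptyElim i⟩
  let g := basisOfLinearIndependentOfCardEqFinrank hind (Module.finrank_eq_card_basis b).symm
  have hg : ∀ i, g i = f i := fun i => by simp [g]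
  refine ⟨g, fun i hi => by simp [hg, f, hi], fun i hi => by simp [hg, f, hi],
    fun i hi z => ?_⟩
  have : g.coord i = (b.repr (w i) i)⁻¹ • b.coord i := by
    refine g.ext fun j => ?_
    simp only [LinearMap.smul_apply, Module.Basis.coord_apply, smul_eq_mul]
    rw [hg j]
    by_cases hj : j = i
    · subst hj
      rw [hfi j hi, inv_mul_cancel₀ (h0 j hi), ← hg]
      simp
    · rw [hf i hi j hj, mul_zero, ← hg]
      simp [hj]
  simpa using congrArg (fun φ => φ z) this

namespace IsMinimalInteriorPoint

open Classical in
theorem card_nonint_repr_le (h : IsMinimalInteriorPoint M V ht d k x) (hb : ∀ i, b i ∈ V) {z : E}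
    (hz : z ∈ M) : (Finset.univ.filter fun i => b.repr z i ∉ realIntegers).card ≤ 2 * d := by
  have hbM : ∀ i, b i ∈ M := fun i => h.mem_of_mem _ (hb i)
  have hb1 : ∀ i, ht (b i) = 1 := fun i => h.ht_eq_one _ (hb i)
  have key : ∀ y ∈ M, (Module.finrank ℝ E : ℝ) - d ≤ ∑ i, (b.repr y i + (1 - ⌈b.repr y i⌉ : ℤ)) := by
    intro y hy
    have hrep : ∀ i, b.repr (y + ∑ i, ((1 - ⌈b.repr y i⌉ : ℤ) : ℝ) • b i) i =
        b.repr y i + (1 - ⌈b.repr y i⌉ : ℤ) := fun i => by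
      rw [map_add, Finsupp.add_apply, b.repr_sum_self]
    have := h.le_ht _ (M.add_mem hy (sum_intCast_smul_mem hbM fun i => 1 - ⌈b.repr y i⌉))
      (mem_conicInterior_of_repr_pos b hb fun i => by
        rw [hrep]; push_cast; linarith [Int.ceil_lt_add_one (b.repr y i)])
    rw [ht_eq_sum_repr hb1] at this
    simpa only [hrep] using this
  have h1 := key z hz
  have h2 := key (-z) (M.neg_mem hz)
  have h3 : ∑ i, (b.repr z i + (1 - ⌈b.repr z i⌉ : ℤ)) +
      ∑ i, (b.repr (-z) i + (1 - ⌈b.repr (-z) i⌉ : ℤ)) ≤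
      ∑ i, ((2 : ℝ) - if b.repr z i ∉ realIntegers then 1 else 0) := by
    rw [← Finset.sum_add_distrib]
    refine Finset.sum_le_sum fun i _ => ?_
    simp only [map_neg, Finsupp.neg_apply, Int.ceil_neg]
    push_cast
    by_cases hi : b.repr z i ∈ realIntegers
    · rw [if_neg (not_not.2 hi)]
      have : (⌊b.repr z i⌋ : ℝ) ≤ ⌈b.repr z i⌉ := (Int.floor_le _).trans (Int.le_ceil _)
      linarith
    · rw [if_pos hi]
      have : (⌊b.repr z i⌋ : ℝ) + 1 ≤ ⌈b.repr z i⌉ := by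
        have h4 : ⌊b.repr z i⌋ < ⌈b.repr z i⌉ := by
          have hle := Int.floor_le (b.repr z i)
          have hne : (⌊b.repr z i⌋ : ℝ) ≠ b.repr z i := fun h => hi ⟨_, h⟩
          exact_mod_cast lt_of_lt_of_le (lt_of_le_of_ne hle hne) (Int.le_ceil _)
        exact_mod_cast h4
      linarith
  rw [Finset.sum_sub_distrib, Finset.sum_boole] at h3
  rw [Module.finrank_eq_card_basis b] at h1 h2
  simp only [Finset.sum_const, Finset.card_univ, nsmul_eq_mul] at h3
  have : ((Finset.univ.filter fun i => b.repr z i ∉ realIntegers).card : ℝ) ≤ 2 * d := by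
    linarith
  exact_mod_cast this

open Classical in
theorem card_exists_nonint_repr_le (h : IsMinimalInteriorPoint M V ht d k x) (hb : ∀ i, b i ∈ V) :
    (Finset.univ.filter fun i => ∃ z ∈ M, b.repr z i ∉ realIntegers).card ≤ 4 * d := by
  let K : κ → AddSubgroup M := fun i =>
    realIntegers.comap ((b.coord i).toAddMonoidHom.comp M.subtype)
  have hK : ∀ i (z : M), z ∈ K i ↔ b.repr (z : E) i ∈ realIntegers := fun i z => Iff.rfl
  obtain ⟨z, hz⟩ := exists_notMem_half_of_ne_top K
    (Finset.univ.filter fun i => ∃ z ∈ M, b.repr z i ∉ realIntegers) (fun i hi htop => by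
      obtain ⟨z, hz, hzi⟩ := (Finset.mem_filter.1 hi).2
      exact hzi ((hK i ⟨z, hz⟩).1 (htop ▸ AddSubgroup.mem_top _)))
  refine hz.trans ?_
  have := h.card_nonint_repr_le hb z.2
  refine (Nat.mul_le_mul_left 2 ((Finset.card_le_card fun i hi => ?_).trans this)).trans
    (by omega)
  exact Finset.mem_filter.2 ⟨Finset.mem_univ _, (Finset.mem_filter.1 hi).2⟩

theorem mem_conicInterior_of_repr (h : IsMinimalInteriorPoint M V ht d k x) (hb : ∀ i, b i ∈ V)
    {y : E} (hy : ∀ i, 0 ≤ b.repr y i) (hxy : ∀ i, 0 < b.repr x i → 0 < b.repr y i)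
    (hx : ∀ i, 0 ≤ b.repr x i) : y ∈ conicInterior V := by
  classical
  obtain ⟨ε, hε, hpos⟩ := exists_pos_forall_sub_mul_pos
    (Finset.univ.filter fun i => 0 < b.repr x i) (b.repr y) (b.repr x)
    fun i hi => hxy i (Finset.mem_filter.1 hi).2
  refine mem_conicInterior_of_sub_smul_mem h.self_interior hε ?_
  rw [← b.sum_repr (y - ε • x)]
  refine sum_smul_mem_conicHull _ _ _ (fun i _ => ?_) fun i _ => mem_conicHull_of_mem (hb i)
  simp only [map_sub, map_smul, Finsupp.sub_apply, Finsupp.smul_apply, smul_eq_mul]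
  rcases (hx i).lt_or_eq with hi | hi
  · exact (hpos i (by simpa using hi)).le
  · rw [← hi]; simpa using hy i

theorem repr_self_le_one (h : IsMinimalInteriorPoint M V ht d k x) (hb : ∀ i, b i ∈ V)
    (hx : ∀ i, 0 ≤ b.repr x i) (i : κ) : b.repr x i ≤ 1 := by
  classical
  by_contra! hi
  have hrep : ∀ j, b.repr (x - b i) j = b.repr x j - if i = j then 1 else 0 := fun j => by
    simp [Finsupp.single_apply]
  have hpos : ∀ j, 0 < b.repr x j → 0 < b.repr (x - b i) j := fun j hj => by
    rw [hrep]
    split_ifs with hij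
    · subst hij; linarith
    · simpa using hj
  have hint : x - b i ∈ conicInterior V := h.mem_conicInterior_of_repr hb (fun j => by
    rcases (hx j).lt_or_eq with hj | hj
    · exact (hpos j hj).le
    · rw [hrep, if_neg (fun hij => by subst hij; linarith), ← hj]; simp) hpos hx
  have := h.le_ht _ (M.sub_mem h.self_mem (h.mem_of_mem _ (hb i))) hint
  rw [map_sub, h.ht_self, h.ht_eq_one _ (hb i)] at this
  linarith

open Classical in
theorem card_repr_self_eq_zero_le (h : IsMinimalInteriorPoint M V ht d k x) (hb : ∀ i, b i ∈ V)
    (hx : ∀ i, 0 ≤ b.repr x i) :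
    (Finset.univ.filter fun i => b.repr x i = 0).card ≤ d := by
  have h1 := h.ht_self
  rw [ht_eq_sum_repr (fun i => h.ht_eq_one _ (hb i)), Module.finrank_eq_card_basis b] at h1
  have h2 : ∑ i, b.repr x i ≤ ∑ i, ((1 : ℝ) - if b.repr x i = 0 then 1 else 0) :=
    Finset.sum_le_sum fun i _ => by
      split_ifs with hi
      · rw [hi]; simp
      · simpa using h.repr_self_le_one hb hx i
  rw [Finset.sum_sub_distrib, Finset.sum_boole] at h2
  simp only [Finset.sum_const, Finset.card_univ, nsmul_eq_mul] at h2
  have : ((Finset.univ.filter fun i => b.repr x i = 0).card : ℝ) ≤ d := by linarith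
  exact_mod_cast this

open Classical in
theorem card_repr_self_fractional_le (h : IsMinimalInteriorPoint M V ht d k x)
    (hb : ∀ i, b i ∈ V) (hx : ∀ i, 0 ≤ b.repr x i) :
    (Finset.univ.filter fun i => b.repr x i ≠ 0 ∧ b.repr x i ≠ 1).card ≤ 2 * d := by
  refine (Finset.card_le_card fun i hi => ?_).trans (h.card_nonint_repr_le hb h.self_mem)
  obtain ⟨h0, h1⟩ := (Finset.mem_filter.1 hi).2
  refine Finset.mem_filter.2 ⟨Finset.mem_univ _, ?_⟩
  rintro ⟨a, ha⟩
  have ha' : (a : ℝ) = b.repr x i := ha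
  have h2 : (0 : ℝ) < a := by rw [ha']; exact lt_of_le_of_ne (hx i) (Ne.symm h0)
  have h3 : (a : ℝ) < 1 := by
    rw [ha']; exact lt_of_le_of_ne (h.repr_self_le_one hb hx i) h1
  have h4 : 0 < a := by exact_mod_cast h2
  have h5 : a < 1 := by exact_mod_cast h3
  omega

end IsMinimalInteriorPoint

theorem exists_repr_self_lower_bound (d k : ℕ) : ∃ c : ℝ, 0 < c ∧ c ≤ 1 ∧
    ∀ {E : Type} [AddCommGroup E] [Module ℝ E] [FiniteDimensional ℝ E] {M : AddSubgroup E}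
      {V : Finset E} {ht : E →ₗ[ℝ] ℝ} {x : E} (_ : IsMinimalInteriorPoint M V ht d k x)
      {κ : Type} [Fintype κ] {b : Module.Basis κ ℝ E}, (∀ i, b i ∈ V) → (∀ i, 0 ≤ b.repr x i) →
      ∀ i, 0 < b.repr x i → c ≤ b.repr x i := by
  classical
  obtain ⟨c, hc0, hc1, hc⟩ := exists_coord_lower_bound (2 * d) k
  refine ⟨c, hc0, hc1, ?_⟩
  intro E _ _ _ M V ht x h κ _ b hb hx i hi
  by_cases hi1 : b.repr x i = 1
  · rw [hi1]; exact hc1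
  have hb1 : ∀ i, ht (b i) = 1 := fun i => h.ht_eq_one _ (hb i)
  let P : κ → Prop := fun i => b.repr x i ≠ 0 ∧ b.repr x i ≠ 1
  have hP : ∀ i, ¬ P i → b.repr x i = 0 ∨ b.repr x i = 1 := fun i hi => by
    simp only [P] at hi; tauto
  have hsum : ∀ f : κ → ℝ, ∑ i, f i = ∑ i : {i // P i}, f i + ∑ i : {i // ¬ P i}, f i :=
    fun f => (Fintype.sum_subtype_add_sum_subtype P f).symm
  rcases hc {i // P i} (fun i : {i // P i} => b.repr x i)
    (by
      rw [Fintype.card_subtype]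
      exact h.card_repr_self_fractional_le hb hx)
    (fun i : {i // P i} => lt_of_le_of_ne (hx i) (Ne.symm i.2.1)) (by
      have h1 : ∑ i : {i // ¬ P i}, b.repr x i ∈ realIntegers :=
        realIntegers.sum_mem fun i _ => by
          rcases hP i i.2 with h | h
          · rw [h]; exact realIntegers.zero_mem
          · rw [h]; exact ⟨1, by simp⟩
      have h2 : ht x ∈ realIntegers := h.ht_int _ h.self_mem
      rw [ht_eq_sum_repr hb1, hsum (b.repr x)] at h2
      obtain ⟨a, ha⟩ := (realIntegers.add_mem_cancel_right h1).1 h2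
      exact ⟨a, ha.symm⟩) with hall | ⟨m, a, ha0, hapos, j, hj⟩
  · exact hall ⟨i, hi.ne', hi1⟩
  exfalso
  let n : κ → ℤ := fun i => if hi : P i then a ⟨i, hi⟩ else if b.repr x i = 1 then m else 0
  let z : E := (m : ℝ) • x - ∑ i, (n i : ℝ) • b i
  have hzr : ∀ i, b.repr z i = m * b.repr x i - n i := fun i => by
    simp only [z, map_sub, map_smul, Finsupp.sub_apply, Finsupp.smul_apply, smul_eq_mul]
    rw [b.repr_sum_self]
  have hz1 : ∀ i (hi : P i), b.repr z i = m * b.repr x i - a ⟨i, hi⟩ := fun i hi => by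
    rw [hzr]; simp [n, hi]
  have hz2 : ∀ i, ¬ P i → b.repr z i = 0 := fun i hi => by
    rw [hzr]
    rcases hP i hi with h | h <;> simp [n, hi, h]
  have hzM : z ∈ M := by
    refine M.sub_mem ?_ (sum_intCast_smul_mem (fun i => h.mem_of_mem _ (hb i)) n)
    rw [Nat.cast_smul_eq_nsmul]
    exact M.nsmul_mem h.self_mem m
  have hzht : ht z = 0 := by
    have e2 : ∑ i : {i // ¬ P i}, b.repr z i = 0 := Finset.sum_eq_zero fun i _ => hz2 i i.2
    rw [ht_eq_sum_repr hb1, hsum, e2, add_zero]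
    exact (Finset.sum_congr rfl fun (i : {i // P i}) _ => hz1 i i.2).trans ha0
  have hz0 := h.eq_zero_of_progression z hzM hzht fun t ht => by
    have hrep : ∀ i, b.repr (x + (t : ℝ) • z) i = b.repr x i + t * b.repr z i := fun i => by simp
    have hpos : ∀ i, 0 < b.repr x i → 0 < b.repr (x + (t : ℝ) • z) i := fun i hi => by
      rw [hrep]
      by_cases hPi : P i
      · rw [hz1 i hPi]; exact hapos t ht ⟨i, hPi⟩
      · rw [hz2 i hPi]; simpa using hi
    refine h.mem_conicInterior_of_repr hb (fun i => ?_) hpos hx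
    rcases (hx i).lt_or_eq with hi | hi
    · exact (hpos i hi).le
    · rw [hrep, hz2 i (fun hPi => hPi.1 hi.symm), ← hi]; simp
  have := hz1 j j.2
  rw [hz0] at this
  apply hj
  simp at this
  linarith

theorem exists_sub_smul_mem_conicHull (d k : ℕ) : ∃ c : ℝ, 0 < c ∧
    ∀ {E : Type} [AddCommGroup E] [Module ℝ E] [FiniteDimensional ℝ E] {M : AddSubgroup E}
      {V : Finset E} {ht : E →ₗ[ℝ] ℝ} {x : E}, IsMinimalInteriorPoint M V ht d k x →
      ∀ v ∈ V, x - c • v ∈ conicHull V := by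
  classical
  obtain ⟨c, hc0, -, hc⟩ := exists_repr_self_lower_bound d k
  refine ⟨c, hc0, ?_⟩
  intro E _ _ _ M V ht x h v hv
  obtain ⟨ε, hε, l, hl, hlx⟩ := h.self_interior (∑ i : V, (i : E))
  have hx : ∑ i : V, (l i + ε) • (i : E) = x := by
    simp only [add_smul, Finset.sum_add_distrib, hlx, ← Finset.smul_sum]
    abel
  obtain ⟨W, b, hWV, hb, hnn, hcost⟩ := exists_basis_repr_nonneg h.ht_eq_one h.span_eq_top
    (fun u => if u = v then -1 else 0) (fun i : V => l i + ε)
    fun i => add_nonneg (hl i) hε.le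
  rw [hx] at hnn hcost
  have hR : ∑ i : V, (if (i : E) = v then (-1 : ℝ) else 0) * (l i + ε) < 0 := by
    rw [Finset.sum_eq_single ⟨v, hv⟩]
    · simp; linarith [hl ⟨v, hv⟩]
    · intro i _ hi
      rw [if_neg (fun h => hi (Subtype.ext h)), zero_mul]
    · simp
  have hbV : ∀ i, b i ∈ V := fun i => by rw [hb]; exact hWV i.2
  obtain ⟨i, -, hi⟩ := Finset.exists_lt_of_sum_lt
    (lt_of_le_of_lt hcost (hR.trans_eq (Finset.sum_const_zero (ι := W)).symm))
  have hiv : (i : E) = v := by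
    by_contra hne
    simp [hne] at hi
  have hpos : 0 < b.repr x i := by simpa [hiv] using hi
  have hle := hc h hbV hnn i hpos
  rw [← b.sum_repr (x - c • v)]
  refine sum_smul_mem_conicHull _ _ _ (fun j _ => ?_) fun j _ => mem_conicHull_of_mem (hbV j)
  rw [← hiv, ← hb i]
  simp only [map_sub, map_smul, Finsupp.sub_apply, Finsupp.smul_apply, b.repr_self,
    Finsupp.single_apply, smul_eq_mul]
  split_ifs with hij
  · subst hij; linarith
  · simpa using hnn j

end Core

section Core

variable {E : Type} [AddCommGroup E] [Module ℝ E]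
  {M : AddSubgroup E} {V : Finset E} {ht : E →ₗ[ℝ] ℝ} {d k : ℕ} {x : E}
  {κ : Type} [Fintype κ] {b : Module.Basis κ ℝ E}

theorem add_mem_conicInterior_of_small {x : E} (hx : x ∈ conicInterior V) {c : ℝ}
    (hc : ∀ v ∈ V, x - c • v ∈ conicHull V) (hb : ∀ i, b i ∈ V) (U : Finset κ) {q : ℕ}
    (hU : U.card < q) {y : E} (hy0 : ∀ i, i ∉ U → b.repr y i = 0)
    (hy : ∀ i ∈ U, |b.repr y i| ≤ c / q) : x + y ∈ conicInterior V := by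
  classical
  have hq : (0 : ℝ) < q := by exact_mod_cast Nat.zero_lt_of_lt hU
  have hUq : (U.card : ℝ) < q := by exact_mod_cast hU
  have hyU : y = ∑ i ∈ U, b.repr y i • b i := by
    conv_lhs => rw [← b.sum_repr y]
    exact (Finset.sum_subset (Finset.subset_univ U) fun i _ hi => by rw [hy0 i hi, zero_smul]).symm
  have hsplit : x + y = (1 - U.card / q : ℝ) • x +
      (∑ i ∈ U, (1 / q : ℝ) • (x - c • b i) + ∑ i ∈ U, (c / q + b.repr y i) • b i) := by
    have e1 : ∑ i ∈ U, (1 / q : ℝ) • (x - c • b i) =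
        ((U.card : ℝ) / q) • x - ∑ i ∈ U, (c / q) • b i := by
      simp only [smul_sub, Finset.sum_sub_distrib, Finset.sum_const, smul_smul]
      rw [← Nat.cast_smul_eq_nsmul ℝ, smul_smul]
      congr 2
      · ring
      · exact funext fun i => by rw [one_div_mul_eq_div]
    have e2 : ∑ i ∈ U, (c / q + b.repr y i) • b i = ∑ i ∈ U, (c / q) • b i + y := by
      simp only [add_smul, Finset.sum_add_distrib]
      rw [← hyU]
    rw [e1, e2, sub_smul, one_smul]
    abel
  rw [hsplit]
  refine conicInterior_add_mem (smul_mem_conicInterior ?_ hx) (add_mem_conicHull ?_ ?_)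
  · rw [sub_pos, div_lt_one hq]; exact hUq
  · exact sum_smul_mem_conicHull _ _ _ (fun i _ => by positivity) fun i _ => hc _ (hb i)
  · exact sum_smul_mem_conicHull _ _ _
      (fun i hi => by linarith [neg_le_of_abs_le (hy i hi)]) fun i _ => mem_conicHull_of_mem (hb i)

theorem eq_zero_of_mem_realIntegers_of_abs_lt_one {r : ℝ} (hr : r ∈ realIntegers) (h : |r| < 1) :
    r = 0 := by
  obtain ⟨a, rfl⟩ := hr
  have h' : |(a : ℝ)| < 1 := h
  have : |a| < 1 := by exact_mod_cast h'
  simp [Int.abs_lt_one_iff.1 this]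

theorem exists_common_multiple_of_coords (d k : ℕ) : ∃ D : ℕ, 1 ≤ D ∧
    ∀ {E : Type} [AddCommGroup E] [Module ℝ E] [FiniteDimensional ℝ E] {M : AddSubgroup E}
      {V : Finset E} {ht : E →ₗ[ℝ] ℝ} {x : E} (_ : IsMinimalInteriorPoint M V ht d k x)
      {κ : Type} [Fintype κ] {b : Module.Basis κ ℝ E}, (∀ i, b i ∈ V) →
      ∀ z ∈ M, ∀ i, D * b.repr z i ∈ realIntegers := by
  classical
  obtain ⟨c, hc0, hc⟩ := exists_sub_smul_mem_conicHull d k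
  obtain ⟨B, hB⟩ := exists_simultaneous_approximation (4 * d)
    (min c 1 / ((4 * d + 1 : ℕ) * (k + 1 : ℕ)))
    (by have : 0 < min c 1 := lt_min hc0 one_pos
        positivity)
  refine ⟨B.factorial, Nat.factorial_pos _, ?_⟩
  intro E _ _ _ M V ht x h κ _ b hb z hz i
  let U := Finset.univ.filter fun i => ∃ z ∈ M, b.repr z i ∉ realIntegers
  have hU : U.card ≤ 4 * d := h.card_exists_nonint_repr_le hb
  have hUint : ∀ i, i ∉ U → ∀ z ∈ M, b.repr z i ∈ realIntegers := fun i hi z hz => by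
    by_contra hcon
    exact hi (Finset.mem_filter.2 ⟨Finset.mem_univ _, z, hz, hcon⟩)
  obtain ⟨m, hm1, hmB, a, ha⟩ := hB {i // i ∈ U} (fun i => b.repr z i) (by simpa using hU)
  have hmz : ∀ i, i ∉ U → ∃ n : ℤ, (n : ℝ) = m * b.repr z i := fun i hi => by
    have := realIntegers.nsmul_mem (hUint i hi z hz) m
    rw [nsmul_eq_mul] at this
    exact this
  choose n₀ hn₀ using hmz
  let n : κ → ℤ := fun i => if hi : i ∈ U then a ⟨i, hi⟩ else n₀ i hi
  let y : E := (m : ℝ) • z - ∑ i, (n i : ℝ) • b i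
  have hyr : ∀ i, b.repr y i = m * b.repr z i - n i := fun i => by
    simp only [y, map_sub, map_smul, Finsupp.sub_apply, Finsupp.smul_apply, smul_eq_mul]
    rw [b.repr_sum_self]
  have hy0 : ∀ i, i ∉ U → b.repr y i = 0 := fun i hi => by
    rw [hyr]; simp [n, hi, hn₀]
  set η : ℝ := min c 1 / ((4 * d + 1 : ℕ) * (k + 1 : ℕ)) with hη
  have hy1 : ∀ i ∈ U, |b.repr y i| < η := fun i hi => by
    rw [hyr]; simpa [n, hi] using ha ⟨i, hi⟩
  have hyM : y ∈ M := by
    refine M.sub_mem ?_ (sum_intCast_smul_mem (fun i => h.mem_of_mem _ (hb i)) n)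
    rw [Nat.cast_smul_eq_nsmul]
    exact M.nsmul_mem hz m
  have hd1 : (0 : ℝ) < (4 * d + 1 : ℕ) := by positivity
  have hk1 : (1 : ℝ) ≤ (k + 1 : ℕ) := by push_cast; linarith [Nat.cast_nonneg (α := ℝ) k]
  have hη0 : 0 < η := by
    have : 0 < min c 1 := lt_min hc0 one_pos
    positivity
  have hηk : η * (k + 1 : ℕ) = min c 1 / (4 * d + 1 : ℕ) := by
    rw [hη]; field_simp
  have hyht : ht y = 0 := by
    refine eq_zero_of_mem_realIntegers_of_abs_lt_one (h.ht_int _ hyM) ?_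
    rw [ht_eq_sum_repr (fun i => h.ht_eq_one _ (hb i)),
      ← Finset.sum_subset (Finset.subset_univ U) fun i _ hi => hy0 i hi]
    calc |∑ i ∈ U, b.repr y i| ≤ ∑ i ∈ U, |b.repr y i| := Finset.abs_sum_le_sum_abs _ _
      _ ≤ ∑ i ∈ U, η := Finset.sum_le_sum fun i hi => (hy1 i hi).le
      _ = U.card * η := by rw [Finset.sum_const, nsmul_eq_mul]
      _ ≤ (4 * d : ℕ) * η := by gcongr
      _ < (4 * d + 1 : ℕ) * η := by gcongr; omega
      _ ≤ (4 * d + 1 : ℕ) * (η * (k + 1 : ℕ)) := by gcongr; nlinarith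
      _ ≤ 1 := by
        rw [hηk, mul_div_cancel₀ _ hd1.ne']
        exact min_le_right _ _
  have hyz : y = 0 := h.eq_zero_of_progression y hyM hyht fun t ht => by
    refine add_mem_conicInterior_of_small h.self_interior (hc h) hb U
      (Nat.lt_succ_of_le hU) (fun i hi => by simp [hy0 i hi]) fun i hi => ?_
    rw [map_smul, Finsupp.smul_apply, smul_eq_mul, abs_mul, Nat.abs_cast]
    have htk : (t : ℝ) ≤ (k + 1 : ℕ) := by exact_mod_cast ht.trans (Nat.le_succ k)
    calc t * |b.repr y i| ≤ (k + 1 : ℕ) * η := by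
          gcongr
          exact (hy1 i hi).le
      _ = min c 1 / (4 * d + 1 : ℕ) := by rw [mul_comm, hηk]
      _ ≤ c / (4 * d + 1 : ℕ) := by gcongr; exact min_le_left _ _
  obtain ⟨e, he⟩ := Nat.dvd_factorial hm1 hmB
  have hmi : m * b.repr z i = n i := by
    have := hyr i
    rw [hyz] at this
    simp at this
    linarith
  refine ⟨e * n i, ?_⟩
  simp only [Int.coe_castAddHom, he]
  push_cast
  rw [← hmi]
  ring

theorem exists_denominator (d k : ℕ) : ∃ D : ℕ, 1 ≤ D ∧
    ∀ {E : Type} [AddCommGroup E] [Module ℝ E] [FiniteDimensional ℝ E] {M : AddSubgroup E}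
      {V : Finset E} {ht : E →ₗ[ℝ] ℝ} {x : E} (_ : IsMinimalInteriorPoint M V ht d k x)
      {κ : Type} [Fintype κ] {b : Module.Basis κ ℝ E}, (∀ i, b i ∈ V) →
      (∀ z ∈ M, ∀ i, D * b.repr z i ∈ realIntegers) ∧ ∀ w ∈ V, ∀ i, |b.repr w i| ≤ D := by
  classical
  obtain ⟨D, hD1, hD⟩ := exists_common_multiple_of_coords d k
  refine ⟨D, hD1, ?_⟩
  intro E _ _ _ M V ht x h κ _ b hb
  refine ⟨hD h hb, fun w hw i => ?_⟩
  by_cases h0 : b.repr w i = 0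
  · simp [h0]
  obtain ⟨g, hg1, hg2, hg⟩ := exists_basis_exchange b {i} (fun _ => w) (by simpa using h0)
    (fun j hj j' hj' hne => by simp at hj hj'; exact absurd (hj.trans hj'.symm) hne)
  have hgV : ∀ j, g j ∈ V := fun j => by
    by_cases hj : j ∈ ({i} : Finset κ)
    · rw [hg1 j hj]; exact hw
    · rw [hg2 j hj]; exact hb j
  have h1 := hD h hgV (b i) (h.mem_of_mem _ (hb i)) i
  rw [hg i (by simp)] at h1
  simp only [Module.Basis.repr_self, Finsupp.single_eq_same, mul_one] at h1
  have hD0 : (0 : ℝ) < D := by exact_mod_cast hD1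
  by_contra! hlt
  have hpos : 0 < |b.repr w i| := abs_pos.2 h0
  have := eq_zero_of_mem_realIntegers_of_abs_lt_one h1 (by
    rw [abs_mul, abs_inv, Nat.abs_cast, ← div_eq_mul_inv, div_lt_one hpos]
    exact hlt)
  exact mul_ne_zero hD0.ne' (inv_ne_zero h0) this

open Filter Topology in
/-- Perturbation criterion for a nonnegative combination to be an interior point. -/
theorem mem_conicInterior_of_perturb (hb : ∀ i, b i ∈ V) (E₀ : Finset κ) {u w : E}
    (hu : u ∈ conicHull V) (hw : w ∈ conicHull V)
    (hs : ∀ i ∈ E₀, b.repr (∑ j ∈ E₀, b j + u) i = 0) (β : κ → ℝ) (hβ : ∀ i, 0 ≤ β i)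
    (γ σ : ℝ) (hγ : 0 ≤ γ) (hγσ : 0 < γ ∨ σ ≤ 0)
    (hcond : ∀ i, 0 < β i ∨ i ∈ E₀ ∨
      (b.repr (∑ j ∈ E₀, b j + u) i = 0 ∧ 0 < σ * b.repr w i)) :
    ∑ i, β i • b i + γ • w ∈ conicInterior V := by
  classical
  set s := ∑ j ∈ E₀, b j + u with hsdef
  let c : ℝ → κ → ℝ := fun ε i =>
    β i + (if i ∈ E₀ then ε else 0) - ε * b.repr s i + ε ^ 2 * (σ * b.repr w i)
  have hlin : ∀ r : ℝ, Tendsto (fun ε : ℝ => 1 + ε * r) (𝓝[>] 0) (𝓝 (1 + 0 * r)) := fun r =>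
    Tendsto.mono_left (Continuous.tendsto (by fun_prop) _) nhdsWithin_le_nhds
  have hev : ∀ᶠ ε : ℝ in 𝓝[>] 0, 0 < ε ∧ (∀ i, 0 < c ε i) ∧ 0 ≤ γ - ε ^ 2 * σ := by
    refine Eventually.and self_mem_nhdsWithin (Eventually.and (eventually_all.2 fun i => ?_) ?_)
    · rcases hcond i with h | h | ⟨h1, h2⟩
      · have : Tendsto (fun ε : ℝ => c ε i) (𝓝[>] 0) (𝓝 (c 0 i)) := by
          refine Tendsto.mono_left (Continuous.tendsto ?_ _) nhdsWithin_le_nhds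
          by_cases hi : i ∈ E₀ <;> simp only [c, hi, if_true, if_false] <;> fun_prop
        exact this.eventually_const_lt (by simpa [c] using h)
      · filter_upwards [(hlin (σ * b.repr w i)).eventually_const_lt
          (by norm_num : (0 : ℝ) < 1 + 0 * (σ * b.repr w i)), self_mem_nhdsWithin] with ε h1 h2
        simp only [c, if_pos h, hs i h]
        have := hβ i
        have := mul_pos (show (0 : ℝ) < ε from h2) h1
        nlinarith
      · filter_upwards [self_mem_nhdsWithin] with ε hε
        simp only [c, h1]
        have h3 : (0 : ℝ) < ε := hε
        have := hβ i
        have : 0 ≤ if i ∈ E₀ then ε else 0 := by split_ifs <;> linarith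
        have : 0 < ε ^ 2 * (σ * b.repr w i) := by positivity
        linarith
    · rcases hγσ with h | h
      · have : Tendsto (fun ε : ℝ => γ - ε ^ 2 * σ) (𝓝[>] 0) (𝓝 (γ - 0 ^ 2 * σ)) :=
          Tendsto.mono_left (Continuous.tendsto (by fun_prop) _) nhdsWithin_le_nhds
        exact (this.eventually_const_lt (by simpa using h)).mono fun ε hε => hε.le
      · exact Eventually.of_forall fun ε => by nlinarith [sq_nonneg ε]
  obtain ⟨ε, hε, hc, hg⟩ := hev.exists
  have hsplit : ∑ i, β i • b i + γ • w =
      ∑ i, c ε i • b i + (ε • u + (γ - ε ^ 2 * σ) • w) := by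
    have e1 : ∑ i, (if i ∈ E₀ then ε else 0) • b i = ε • ∑ j ∈ E₀, b j := by
      simp only [ite_smul, zero_smul, Finset.sum_ite_mem, Finset.univ_inter, Finset.smul_sum]
    have e2 : ∑ i, (ε * b.repr s i) • b i = ε • s := by
      conv_rhs => rw [← b.sum_repr s, Finset.smul_sum]
      simp only [mul_smul]
    have e3 : ∑ i, (ε ^ 2 * (σ * b.repr w i)) • b i = (ε ^ 2 * σ) • w := by
      conv_rhs => rw [← b.sum_repr w, Finset.smul_sum]
      simp only [mul_smul]
    simp only [c, add_smul, sub_smul, Finset.sum_add_distrib, Finset.sum_sub_distrib]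
    rw [e1, e2, e3, hsdef, smul_add]
    abel
  rw [hsplit]
  refine conicInterior_add_mem (mem_conicInterior_of_repr_pos b hb fun i => ?_)
    (add_mem_conicHull (smul_mem_conicHull hε.le hu) (smul_mem_conicHull hg hw))
  rw [b.repr_sum_self]
  exact hc i

end Core

section Core

variable {E : Type} [AddCommGroup E] [Module ℝ E]
  {M : AddSubgroup E} {V : Finset E} {ht : E →ₗ[ℝ] ℝ} {d k : ℕ} {x : E}
  {κ : Type} [Fintype κ] {b : Module.Basis κ ℝ E}

namespace IsMinimalInteriorPoint

/-- An integral nonnegative combination which is interior by the perturbation criterion has large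
coefficient sum. -/
theorem le_sum_of_perturb (h : IsMinimalInteriorPoint M V ht d k x) (hb : ∀ i, b i ∈ V) {w : E}
    (hw : w ∈ V) (β : κ → ℤ) (hβ : ∀ i, 0 ≤ β i) (γ σ : ℤ) (hγ : 0 ≤ γ) (hγσ : 0 < γ ∨ σ ≤ 0)
    (hcond : ∀ i, 0 < β i ∨ 0 < σ * b.repr w i) :
    (Fintype.card κ : ℝ) - d ≤ ∑ i, (β i : ℝ) + γ := by
  have hint := mem_conicInterior_of_perturb (b := b) hb ∅ (zero_mem_conicHull (V := V))
    (mem_conicHull_of_mem hw) (by simp) (fun i => (β i : ℝ))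
    (fun i => by exact_mod_cast hβ i) γ σ (by exact_mod_cast hγ) (by exact_mod_cast hγσ)
    (fun i => by
      rcases hcond i with h | h
      · exact Or.inl (by exact_mod_cast h)
      · exact Or.inr (Or.inr ⟨by simp, h⟩))
  have := h.le_ht _ (M.add_mem (sum_intCast_smul_mem (fun i => h.mem_of_mem _ (hb i)) β) (by
    rw [Int.cast_smul_eq_zsmul]
    exact M.zsmul_mem (h.mem_of_mem _ hw) γ)) hint
  rw [Module.finrank_eq_card_basis b] at this
  simpa [h.ht_eq_one _ hw, h.ht_eq_one _ (hb _)] using this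

open Classical in
theorem card_repr_ne_zero_le (h : IsMinimalInteriorPoint M V ht d k x) (hb : ∀ i, b i ∈ V) {w : E}
    (hw : w ∈ V) : (Finset.univ.filter fun i => b.repr w i ≠ 0).card ≤ 2 * d + 1 := by
  have h1 := h.le_sum_of_perturb hb hw (fun i => if 0 < b.repr w i then 0 else 1)
    (fun i => by split_ifs <;> norm_num) 1 1 (by norm_num) (by norm_num) (fun i => by
      by_cases hi : 0 < b.repr w i <;> simp [hi])
  have h2 := h.le_sum_of_perturb hb hw (fun i => if b.repr w i < 0 then 0 else 1)
    (fun i => by split_ifs <;> norm_num) 0 (-1) (by norm_num) (by norm_num) (fun i => by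
      by_cases hi : b.repr w i < 0 <;> simp [hi])
  have h3 : ∑ i, (((if 0 < b.repr w i then 0 else 1 : ℤ) : ℝ) +
      ((if b.repr w i < 0 then 0 else 1 : ℤ) : ℝ)) ≤
      ∑ i, ((2 : ℝ) - if b.repr w i ≠ 0 then 1 else 0) :=
    Finset.sum_le_sum fun i _ => by
      rcases lt_trichotomy (b.repr w i) 0 with hi | hi | hi
      · simp [hi, hi.ne, not_lt.2 hi.le]; norm_num
      · simp [hi]; norm_num
      · simp [hi, hi.ne', not_lt.2 hi.le]; norm_num
  rw [Finset.sum_add_distrib, Finset.sum_sub_distrib, Finset.sum_boole] at h3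
  simp only [Finset.sum_const, Finset.card_univ, nsmul_eq_mul] at h3
  have : ((Finset.univ.filter fun i => b.repr w i ≠ 0).card : ℝ) ≤ (2 * d + 1 : ℕ) := by
    push_cast at h1 h2 h3 ⊢
    linarith
  exact_mod_cast this

open Classical in
/-- The facet through the basis elements on which `x` vanishes can be completed by few elements of
`V`. -/
theorem exists_small_support (h : IsMinimalInteriorPoint M V ht d k x) (E₀ : Finset κ)
    (hE₀ : ∀ i ∈ E₀, b.repr x i = 0) :
    ∃ (T : Finset E) (l : E → ℝ), T ⊆ V ∧ T.card ≤ E₀.card ∧ (∀ v ∈ T, 0 ≤ l v) ∧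
      ∀ i ∈ E₀, b.repr (∑ j ∈ E₀, b j + ∑ v ∈ T, l v • v) i = 0 := by
  obtain ⟨ε, hε, l, hl, hlx⟩ := h.self_interior (∑ j ∈ E₀, b j)
  let f : V → ({i // i ∈ E₀} → ℝ) := fun v i => b.repr (v : E) i
  have hsumE : ∀ i ∈ E₀, b.repr (∑ j ∈ E₀, b j) i = 1 := fun i hi => by
    simp only [map_sum, Finsupp.finsetSum_apply, b.repr_self, Finsupp.single_apply]
    simp [hi]
  have hf : ∀ l : V → ℝ, ∑ v, l v • f v = fun i : {i // i ∈ E₀} =>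
      b.repr (∑ v, l v • (v : E)) i := fun l => by
    ext i
    simp [f, Finset.sum_apply, map_sum]
  have hε1 : ∀ i : {i // i ∈ E₀}, b.repr (∑ v, l v • (v : E)) i = -ε := fun i => by
    rw [hlx, map_sub, map_smul, Finsupp.sub_apply, Finsupp.smul_apply, hE₀ i i.2, hsumE i i.2]
    simp
  obtain ⟨l', hl', hsum, -, hind⟩ := exists_linearIndepOn_support f 0 (fun r hr _ => by
    obtain ⟨i, hi⟩ := Function.ne_iff.1 hr
    rcases lt_or_gt_of_ne hi with hi | hi
    · exact Or.inl ⟨by simp, i, hi⟩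
    · exact Or.inr ⟨by simp, i, hi⟩) l hl
  let S : Finset V := Finset.univ.filter fun v => l' v ≠ 0
  have hScard : S.card ≤ E₀.card := by
    have hind' : LinearIndependent ℝ fun v : S => f v :=
      hind.comp (fun v : S => (⟨v, (Finset.mem_filter.1 v.2).2⟩ : {v | l' v ≠ 0}))
        fun v v' hv => Subtype.ext (by simpa using hv)
    simpa using hind'.fintype_card_le_finrank
  refine ⟨S.map (Function.Embedding.subtype _),
    fun v => if hv : v ∈ V then ε⁻¹ * l' ⟨v, hv⟩ else 0, fun v hv => ?_, by simpa using hScard,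
    fun v hv => ?_, fun i hi => ?_⟩
  · obtain ⟨u, -, rfl⟩ := Finset.mem_map.1 hv
    exact u.2
  · beta_reduce
    split_ifs with hv'
    · exact mul_nonneg (inv_nonneg.2 hε.le) (hl' _)
    · exact le_rfl
  · have e1 : ∑ v ∈ S.map (Function.Embedding.subtype _),
        (if hv : v ∈ V then ε⁻¹ * l' ⟨v, hv⟩ else 0) • v = ε⁻¹ • ∑ v, l' v • (v : E) := by
      rw [Finset.sum_map, Finset.smul_sum]
      refine (Finset.sum_congr rfl fun v _ => ?_).trans
        (Finset.sum_subset (Finset.subset_univ S) fun v _ hv => ?_)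
      · simp [mul_smul]
      · have : l' v = 0 := by simpa [S] using hv
        simp [this]
    have e2 : b.repr (∑ v, l' v • (v : E)) i = -ε := by
      have := congrFun ((hf l').symm.trans (hsum.trans (hf l))) ⟨i, hi⟩
      simp only at this
      rw [this, hε1 ⟨i, hi⟩]
    rw [e1, map_add, Finsupp.add_apply, hsumE i hi, map_smul, Finsupp.smul_apply, e2, smul_eq_mul]
    field_simp
    norm_num

end IsMinimalInteriorPoint

/-- A bounded part of a basis outside of which the basis elements behave like apexes of
pyramids. -/
theorem exists_basis_with_apexes (d k : ℕ) : ∃ Φ D : ℕ, 1 ≤ D ∧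
    ∀ {E : Type} [AddCommGroup E] [Module ℝ E] [FiniteDimensional ℝ E] {M : AddSubgroup E}
      {V : Finset E} {ht : E →ₗ[ℝ] ℝ} {x : E} (_ : IsMinimalInteriorPoint M V ht d k x),
      ∃ (κ : Type) (_ : Fintype κ) (b : Module.Basis κ ℝ E) (F : Finset κ), (∀ i, b i ∈ V) ∧
        F.card ≤ Φ ∧
        (∀ i, i ∉ F → ∀ z ∈ M, b.repr z i ∈ realIntegers) ∧
        (∀ i, i ∉ F → ∀ w ∈ V, w ≠ b i → b.repr w i = 0) ∧
        (∀ z ∈ M, ∀ i, D * b.repr z i ∈ realIntegers) ∧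
        ∀ w ∈ V, ∀ i, |b.repr w i| ≤ D := by
  classical
  obtain ⟨D, hD1, hD⟩ := exists_denominator d k
  let q := 7 * d + d * (2 * d + 1)
  refine ⟨q + 4 * d + (2 * D ^ 2 + 1) ^ q * k, D, hD1, ?_⟩
  intro E _ _ _ M V ht x h
  obtain ⟨l₀, hl₀, hl₀x⟩ := mem_conicHull_of_mem_conicInterior h.self_interior
  obtain ⟨W, b, hWV, hbW, hnn, -⟩ := exists_basis_repr_nonneg h.ht_eq_one h.span_eq_top 0 l₀ hl₀
  rw [hl₀x] at hnn
  have hb : ∀ i, b i ∈ V := fun i => by rw [hbW]; exact hWV i.2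
  have hbM : ∀ i, b i ∈ M := fun i => h.mem_of_mem _ (hb i)
  obtain ⟨hDint, hDle⟩ := hD h hb
  let E₀ : Finset W := Finset.univ.filter fun i => b.repr x i = 0
  let Fr : Finset W := Finset.univ.filter fun i => b.repr x i ≠ 0 ∧ b.repr x i ≠ 1
  let U : Finset W := Finset.univ.filter fun i => ∃ z ∈ M, b.repr z i ∉ realIntegers
  have hE₀ : E₀.card ≤ d := h.card_repr_self_eq_zero_le hb hnn
  have hFr : Fr.card ≤ 2 * d := h.card_repr_self_fractional_le hb hnn
  have hU : U.card ≤ 4 * d := h.card_exists_nonint_repr_le hb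
  obtain ⟨T, l, hTV, hTcard, hl, hs⟩ := h.exists_small_support E₀ fun i hi =>
    (Finset.mem_filter.1 hi).2
  set u : E := ∑ v ∈ T, l v • v with hu
  have huV : u ∈ conicHull V := sum_smul_mem_conicHull _ _ _ hl fun v hv =>
    mem_conicHull_of_mem (hTV hv)
  let T' : Finset W := T.biUnion fun v => Finset.univ.filter fun i => b.repr v i ≠ 0
  have hT' : T'.card ≤ d * (2 * d + 1) := by
    refine (Finset.card_biUnion_le_card_mul _ _ _ fun v hv =>
      h.card_repr_ne_zero_le hb (hTV hv)).trans ?_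
    gcongr
    exact hTcard.trans hE₀
  let C : Finset W := E₀ ∪ Fr ∪ U ∪ T'
  have hC : C.card ≤ q := by
    have h1 := Finset.card_union_le (E₀ ∪ Fr ∪ U) T'
    have h2 := Finset.card_union_le (E₀ ∪ Fr) U
    have h3 := Finset.card_union_le E₀ Fr
    simp only [q, C]
    omega
  have hCx : ∀ i, i ∉ C → b.repr x i = 1 := fun i hi => by
    simp only [C, E₀, Fr, Finset.mem_union, Finset.mem_filter, Finset.mem_univ, true_and] at hi
    tauto
  have hCE : ∀ i, i ∉ C → i ∉ E₀ := fun i hi hi' => hi (by simp [C, hi'])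
  have hCU : ∀ i, i ∉ C → ∀ z ∈ M, b.repr z i ∈ realIntegers := fun i hi z hz => by
    by_contra hcon
    have : i ∈ U := Finset.mem_filter.2 ⟨Finset.mem_univ _, z, hz, hcon⟩
    exact hi (by simp [C, this])
  have hCs : ∀ i, i ∉ C → b.repr (∑ j ∈ E₀, b j + u) i = 0 := fun i hi => by
    have h1 : b.repr (∑ j ∈ E₀, b j) i = 0 := by
      simp only [map_sum, Finsupp.finsetSum_apply, b.repr_self, Finsupp.single_apply]
      simp [hCE i hi]
    have h2 : b.repr u i = 0 := by
      rw [hu]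
      simp only [map_sum, Finsupp.finsetSum_apply, map_smul, Finsupp.smul_apply]
      refine Finset.sum_eq_zero fun v hv => ?_
      have : b.repr v i = 0 := by
        by_contra hne
        exact hi (Finset.mem_union_right _ (Finset.mem_biUnion.2
          ⟨v, hv, Finset.mem_filter.2 ⟨Finset.mem_univ _, hne⟩⟩))
      rw [this, smul_zero]
    rw [map_add, Finsupp.add_apply, h1, h2, add_zero]
  have hxpos : ∀ i, 0 < b.repr x i ∨ i ∈ E₀ := fun i => by
    rcases (hnn i).lt_or_eq with hi | hi
    · exact Or.inl hi
    · exact Or.inr (by simp [E₀, hi])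
  have key : ∀ (S : Finset W) (γ σ : ℝ) (w : E), w ∈ V → (∀ i ∈ S, i ∉ C) → 0 ≤ γ →
      (0 < γ ∨ σ ≤ 0) → (γ • w ∈ M) → γ < S.card → ∃ i ∈ S, σ * b.repr w i ≤ 0 := by
    intro S γ σ w hw hS hγ hγσ hγM hlt
    by_contra! hcon
    let β : W → ℝ := fun i => b.repr x i - if i ∈ S then 1 else 0
    have hy : ∑ i, β i • b i = x - ∑ i ∈ S, b i := by
      simp only [β, sub_smul, Finset.sum_sub_distrib, b.sum_repr, ite_smul, one_smul, zero_smul,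
        Finset.sum_ite_mem, Finset.univ_inter]
    have hint := mem_conicInterior_of_perturb hb E₀ huV (mem_conicHull_of_mem hw) hs β
      (fun i => by
        by_cases hi : i ∈ S
        · simp [β, hi, hCx i (hS i hi)]
        · simpa [β, hi] using hnn i) γ σ hγ hγσ (fun i => by
        by_cases hi : i ∈ S
        · exact Or.inr (Or.inr ⟨hCs i (hS i hi), hcon i hi⟩)
        · rcases hxpos i with h | h
          · exact Or.inl (by simpa [β, hi] using h)
          · exact Or.inr (Or.inl h))
    rw [hy] at hint
    have := h.le_ht _ (M.add_mem (M.sub_mem h.self_mem (M.sum_mem fun i _ => hbM i)) hγM) hint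
    simp [h.ht_self, h.ht_eq_one _ (hb _), h.ht_eq_one _ hw] at this
    linarith
  have hnonneg : ∀ i, i ∉ C → ∀ w ∈ V, 0 ≤ b.repr w i := fun i hi w hw => by
    obtain ⟨j, hj, hle⟩ := key {i} 0 (-1) w hw (by simpa using hi) le_rfl (Or.inr (by norm_num))
      (by simp) (by simp)
    obtain rfl := Finset.mem_singleton.1 hj
    linarith
  have hdisj : ∀ i j, i ∉ C → j ∉ C → i ≠ j → ∀ w ∈ V, b.repr w i ≠ 0 → b.repr w j = 0 := by
    intro i j hi hj hij w hw hwi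
    obtain ⟨j', hj', hle⟩ := key {i, j} 1 1 w hw (by
        intro j' hj'
        rcases Finset.mem_insert.1 hj' with rfl | hj'
        · exact hi
        · rw [Finset.mem_singleton.1 hj']; exact hj) zero_le_one (Or.inl one_pos)
      (by simpa using h.mem_of_mem _ hw) (by rw [Finset.card_pair hij]; norm_num)
    have h1 := hnonneg i hi w hw
    have h2 := hnonneg j hj w hw
    rcases Finset.mem_insert.1 hj' with rfl | hj'
    · exact absurd (le_antisymm (by linarith) h1) hwi
    · rw [Finset.mem_singleton.1 hj'] at hle
      exact le_antisymm (by linarith) h2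
  let Nn : Finset W := Finset.univ.filter fun i => i ∉ C ∧ ∃ w ∈ V, w ≠ b i ∧ b.repr w i ≠ 0
  have hNn : ∀ i, ∃ w, i ∈ Nn → i ∉ C ∧ w ∈ V ∧ w ≠ b i ∧ b.repr w i ≠ 0 := fun i => by
    by_cases hi : i ∈ Nn
    · obtain ⟨-, h1, w, h2⟩ := Finset.mem_filter.1 hi
      exact ⟨w, fun _ => ⟨h1, h2⟩⟩
    · exact ⟨0, fun hi' => absurd hi' hi⟩
  choose w hw using hNn
  let N₁ : Finset W := Nn.filter fun i => b.repr (w i) i = 1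
  let N₂ : Finset W := Nn.filter fun i => b.repr (w i) i ≠ 1
  have hN₂ : N₂.card ≤ 4 * d := by
    obtain ⟨g, hg1, hg2, hg⟩ := exists_basis_exchange b N₂ w
      (fun i hi => (hw i (Finset.mem_filter.1 hi).1).2.2.2)
      (fun i hi j hj hij => by
        obtain ⟨h1, h2, -, h3⟩ := hw i (Finset.mem_filter.1 hi).1
        exact hdisj i j h1 (hw j (Finset.mem_filter.1 hj).1).1 hij _ h2 h3)
    have hgV : ∀ j, g j ∈ V := fun j => by
      by_cases hj : j ∈ N₂
      · rw [hg1 j hj]; exact (hw j (Finset.mem_filter.1 hj).1).2.1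
      · rw [hg2 j hj]; exact hb j
    refine (Finset.card_le_card fun i hi => ?_).trans (h.card_exists_nonint_repr_le hgV)
    refine Finset.mem_filter.2 ⟨Finset.mem_univ _, b i, hbM i, ?_⟩
    rw [hg i hi]
    simp only [Module.Basis.repr_self, Finsupp.single_eq_same, mul_one]
    rintro ⟨a, ha⟩
    obtain ⟨hiN, hi1⟩ := Finset.mem_filter.1 hi
    obtain ⟨h1, h2, -, h3⟩ := hw i hiN
    obtain ⟨c, hc⟩ := hCU i h1 _ (h.mem_of_mem _ h2)
    have hc' : (c : ℝ) = b.repr (w i) i := hc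
    have ha' : (a : ℝ) = (b.repr (w i) i)⁻¹ := ha
    have hac : a * c = 1 := by
      have : (a : ℝ) * c = 1 := by rw [ha', hc', inv_mul_cancel₀ h3]
      exact_mod_cast this
    have hc0 : 0 ≤ c := by
      have : (0 : ℝ) ≤ c := by rw [hc']; exact hnonneg i h1 _ h2
      exact_mod_cast this
    rcases Int.mul_eq_one_iff_eq_one_or_neg_one.1 hac with ⟨-, h⟩ | ⟨-, h⟩
    · exact hi1 (by rw [← hc', h]; simp)
    · omega
  have hN₁ : N₁.card ≤ (2 * D ^ 2 + 1) ^ q * k := by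
    by_contra! hlt
    have hcoord : ∀ i, ∀ j, ∃ a : ℤ, i ∈ Nn → (a : ℝ) = D * b.repr (w i) j ∧
        a ∈ Finset.Icc (-(D ^ 2 : ℕ) : ℤ) (D ^ 2 : ℕ) := fun i j => by
      by_cases hi : i ∈ Nn
      · obtain ⟨h1, h2, -, h3⟩ := hw i hi
        obtain ⟨a, ha⟩ := hDint _ (h.mem_of_mem _ h2) j
        have ha' : (a : ℝ) = D * b.repr (w i) j := ha
        have h4 : |(a : ℝ)| ≤ (D ^ 2 : ℕ) := by
          rw [ha', abs_mul, Nat.abs_cast]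
          push_cast
          rw [sq]
          gcongr
          exact hDle _ h2 j
        have h5 : |a| ≤ (D ^ 2 : ℕ) := by exact_mod_cast h4
        exact ⟨a, fun _ => ⟨ha', Finset.mem_Icc.2 (abs_le.1 h5)⟩⟩
      · exact ⟨0, fun hi' => absurd hi' hi⟩
    choose a ha using hcoord
    let target : Finset ({j // j ∈ C} → ℤ) :=
      Fintype.piFinset fun _ => Finset.Icc (-(D ^ 2 : ℕ) : ℤ) (D ^ 2 : ℕ)
    have htarget : target.card ≤ (2 * D ^ 2 + 1) ^ q := by
      simp only [target, Fintype.card_piFinset, Finset.prod_const, Int.card_Icc,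
        Finset.card_univ, Fintype.card_coe]
      have : ((D ^ 2 : ℕ) + 1 - -(D ^ 2 : ℕ) : ℤ).toNat = 2 * D ^ 2 + 1 := by omega
      rw [this]
      exact Nat.pow_le_pow_right (by omega) hC
    obtain ⟨f, -, hf⟩ := Finset.exists_lt_card_fiber_of_mul_lt_card_of_maps_to
      (s := N₁) (t := target) (f := fun i j => a i j) (n := k)
      (fun i hi => Fintype.mem_piFinset.2 fun j => (ha i j (Finset.mem_filter.1 hi).1).2)
      (lt_of_le_of_lt (Nat.mul_le_mul_right k htarget) hlt)
    set S := N₁.filter fun i => (fun j : {j // j ∈ C} => a i j) = f with hSdef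
    have hSN : ∀ i ∈ S, i ∈ Nn := fun i hi =>
      (Finset.mem_filter.1 (Finset.mem_filter.1 hi).1).1
    obtain ⟨i₀, hi₀⟩ : S.Nonempty := Finset.card_pos.1 (by omega)
    have hDpos : (0 : ℝ) < D := by exact_mod_cast hD1
    have hrep : ∀ i ∈ S, ∀ j, j ∉ C → b.repr (w i - b i) j = 0 := fun i hi j hj => by
      obtain ⟨h1, h2, -, h3⟩ := hw i (hSN i hi)
      rw [map_sub, Finsupp.sub_apply, b.repr_self, Finsupp.single_apply]
      split_ifs with hij
      · subst hij
        rw [(Finset.mem_filter.1 (Finset.mem_filter.1 hi).1).2, sub_self]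
      · rw [hdisj i j h1 hj hij _ h2 h3, sub_zero]
    have heq : ∀ i ∈ S, w i - b i = w i₀ - b i₀ := fun i hi => by
      refine b.ext_elem fun j => ?_
      by_cases hj : j ∈ C
      · have hij : ∀ i ∈ S, b.repr (w i - b i) j = b.repr (w i) j := fun i hi => by
          rw [map_sub, Finsupp.sub_apply, b.repr_self, Finsupp.single_apply, if_neg, sub_zero]
          rintro rfl
          exact (hw i (hSN i hi)).1 hj
        rw [hij i hi, hij i₀ hi₀]
        have h1 := (ha i j (hSN i hi)).1
        have h2 := (ha i₀ j (hSN i₀ hi₀)).1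
        have h3 : a i j = a i₀ j := congrFun
          ((Finset.mem_filter.1 hi).2.trans (Finset.mem_filter.1 hi₀).2.symm) ⟨j, hj⟩
        rw [h3, h2] at h1
        exact (mul_left_cancel₀ hDpos.ne' h1).symm
      · rw [hrep i hi j hj, hrep i₀ hi₀ j hj]
    have hw₀ := hw i₀ (hSN i₀ hi₀)
    have hzero := h.eq_zero_of_progression (w i₀ - b i₀)
      (M.sub_mem (h.mem_of_mem _ hw₀.2.1) (hbM i₀))
      (by rw [map_sub, h.ht_eq_one _ hw₀.2.1, h.ht_eq_one _ (hb i₀), sub_self]) fun t ht => by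
        have hScard : (0 : ℝ) < S.card := by exact_mod_cast (by omega : 0 < S.card)
        have htS : (t : ℝ) / S.card < 1 := by
          rw [div_lt_one hScard]
          exact_mod_cast lt_of_le_of_lt ht hf
        have hsplit : x + (t : ℝ) • (w i₀ - b i₀) =
            (x - ∑ i ∈ S, ((t : ℝ) / S.card) • b i) + ∑ i ∈ S, ((t : ℝ) / S.card) • w i := by
          have : ∑ i ∈ S, ((t : ℝ) / S.card) • w i - ∑ i ∈ S, ((t : ℝ) / S.card) • b i =
              (t : ℝ) • (w i₀ - b i₀) := by
            rw [← Finset.sum_sub_distrib]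
            simp only [← smul_sub]
            rw [Finset.sum_congr rfl fun i hi => by rw [heq i hi], Finset.sum_const,
              ← Nat.cast_smul_eq_nsmul ℝ, smul_smul, mul_div_cancel₀ _ hScard.ne']
          rw [← this]
          abel
        rw [hsplit]
        have hrep' : ∀ j, b.repr (x - ∑ i ∈ S, ((t : ℝ) / S.card) • b i) j =
            b.repr x j - if j ∈ S then (t : ℝ) / S.card else 0 := fun j => by
          simp only [map_sub, map_sum, map_smul, Finsupp.sub_apply, Finsupp.finsetSum_apply,
            Finsupp.smul_apply, b.repr_self, Finsupp.single_apply]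
          simp
        have hpos : ∀ j, 0 < b.repr x j → 0 < b.repr x j - if j ∈ S then (t : ℝ) / S.card else 0 := by
          intro j hj
          split_ifs with hjS
          · rw [hCx j (hw j (hSN j hjS)).1]; linarith
          · simpa using hj
        refine conicInterior_add_mem (h.mem_conicInterior_of_repr hb (fun j => ?_)
          (fun j hj => by rw [hrep']; exact hpos j hj) hnn)
          (sum_smul_mem_conicHull _ _ _ (fun i _ => div_nonneg (Nat.cast_nonneg _) hScard.le) fun i hi =>
            mem_conicHull_of_mem (hw i (hSN i hi)).2.1)
        rw [hrep']
        rcases (hnn j).lt_or_eq with hj | hj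
        · exact (hpos j hj).le
        · rw [if_neg, ← hj, sub_zero]
          intro hjS
          have := hCx j (hw j (hSN j hjS)).1
          linarith
    exact hw₀.2.2.1 (sub_eq_zero.1 hzero)
  refine ⟨W, inferInstance, b, C ∪ Nn, hb, ?_, fun i hi => hCU i fun hi' => hi (by simp [hi']),
    fun i hi w hw hwi => ?_, hDint, hDle⟩
  · have h1 := Finset.card_union_le C Nn
    have h2 : N₁.card + N₂.card = Nn.card := Finset.card_filter_add_card_filter_not _
    omega
  · by_contra hne
    rw [Finset.mem_union, not_or] at hi
    exact hi.2 (Finset.mem_filter.2 ⟨Finset.mem_univ _, hi.1, w, hw, hwi, hne⟩)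

end Core

open Classical in
theorem sum_dite_mem_smul {E : Type} {V W : Finset E} (h : W ⊆ V) {F : Type} [AddCommGroup F] [Module ℝ F]
    (g : W → ℝ) (f : E → F) :
    ∑ v : V, (if hv : (v : E) ∈ W then g ⟨v, hv⟩ else 0) • f v = ∑ i : W, g i • f i := by
  have e : ∑ i : W, g i • f i = ∑ v ∈ W, (if hv : v ∈ W then g ⟨v, hv⟩ else 0) • f v := by
    rw [← Finset.sum_coe_sort W]
    exact Finset.sum_congr rfl fun i _ => by simp
  rw [e, Finset.sum_subset h fun v _ hv => by rw [dif_neg hv, zero_smul],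
    ← Finset.sum_coe_sort V]

section Triangulation

variable {E : Type} [AddCommGroup E] [Module ℝ E]

/-- A basis consisting of elements of a finite set `V`. -/
structure SubBasis (V : Finset E) where
  carrier : Finset E
  subset : carrier ⊆ V
  basis : Module.Basis carrier ℝ E
  basis_apply : ∀ i, basis i = i

namespace SubBasis

variable {V : Finset E}

theorem carrier_injective : Function.Injective (carrier : SubBasis V → Finset E) := by
  rintro ⟨W, h, b, hb⟩ ⟨W', h', b', hb'⟩ heq
  obtain rfl : W = W' := heq
  have : b = b' := Module.Basis.eq_of_apply_eq fun i => by rw [hb, hb']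
  subst this
  rfl

instance : Finite (SubBasis V) :=
  Finite.of_injective (fun s => (⟨s.carrier, Finset.mem_powerset.2 s.subset⟩ : V.powerset))
    fun s t h => carrier_injective (by simpa using h)

theorem basis_mem (s : SubBasis V) (i : s.carrier) : s.basis i ∈ V := by
  rw [s.basis_apply]; exact s.subset i.2

/-- The linear functional agreeing with `ω` on the basis. -/
noncomputable def cost (s : SubBasis V) (ω : E → ℝ) : E →ₗ[ℝ] ℝ :=
  s.basis.constr ℝ fun i => ω i

theorem cost_apply (s : SubBasis V) (ω : E → ℝ) (z : E) :
    s.cost ω z = ∑ i : s.carrier, ω i * s.basis.repr z i := by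
  rw [cost, Module.Basis.constr_apply_fintype]
  exact Finset.sum_congr rfl fun i _ => by rw [smul_eq_mul, mul_comm]; rfl

theorem cost_of_mem (s : SubBasis V) (ω : E → ℝ) {v : E} (hv : v ∈ s.carrier) :
    s.cost ω v = ω v := by
  have := s.basis.constr_basis ℝ (fun i => ω i) ⟨v, hv⟩
  rwa [s.basis_apply] at this

/-- The basis spans a cell of the regular triangulation induced by `ω`. -/
def IsLower (s : SubBasis V) (ω : E → ℝ) : Prop :=
  ∀ w ∈ V, w ∉ s.carrier → s.cost ω w < ω w

theorem IsLower.subset_of_repr_pos {s t : SubBasis V} {ω : E → ℝ} (hs : s.IsLower ω) {y : E}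
    (ht : ∀ i, 0 < t.basis.repr y i) :
    s.cost ω y ≤ t.cost ω y ∧ (t.cost ω y ≤ s.cost ω y → t.carrier ⊆ s.carrier) := by
  have hle : ∀ i : t.carrier, s.cost ω i ≤ ω i := fun i => by
    by_cases hi : (i : E) ∈ s.carrier
    · exact (s.cost_of_mem ω hi).le
    · exact (hs i (t.subset i.2) hi).le
  have h1 : s.cost ω y = ∑ i : t.carrier, s.cost ω (i : E) * t.basis.repr y i := by
    conv_lhs => rw [← t.basis.sum_repr y]
    rw [map_sum]
    exact Finset.sum_congr rfl fun i _ => by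
      rw [map_smul, t.basis_apply, smul_eq_mul, mul_comm]
  have h2 : ∀ i ∈ Finset.univ, s.cost ω ((i : t.carrier) : E) * t.basis.repr y i ≤
      ω i * t.basis.repr y i := fun i _ => mul_le_mul_of_nonneg_right (hle i) (ht i).le
  rw [h1, cost_apply]
  refine ⟨Finset.sum_le_sum h2, fun h i hi => ?_⟩
  by_contra hcon
  have := Finset.sum_lt_sum h2 ⟨⟨i, hi⟩, Finset.mem_univ _,
    mul_lt_mul_of_pos_right (hs i (t.subset hi) hcon) (ht ⟨i, hi⟩)⟩
  linarith

theorem IsLower.eq_of_repr_pos {s t : SubBasis V} {ω : E → ℝ} (hs : s.IsLower ω)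
    (ht : t.IsLower ω) {y : E} (hys : ∀ i, 0 < s.basis.repr y i)
    (hyt : ∀ i, 0 < t.basis.repr y i) : s = t := by
  obtain ⟨h1, h2⟩ := hs.subset_of_repr_pos hyt
  obtain ⟨h3, h4⟩ := ht.subset_of_repr_pos hys
  exact carrier_injective (subset_antisymm (h4 h1) (h2 h3))

theorem exists_repr_nonneg [FiniteDimensional ℝ E] {ht : E →ₗ[ℝ] ℝ} (hht : ∀ v ∈ V, ht v = 1)
    (hspan : Submodule.span ℝ (V : Set E) = ⊤) (ω : E → ℝ) (l : V → ℝ) (hl : ∀ i, 0 ≤ l i) :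
    ∃ s : SubBasis V, (∀ i, 0 ≤ s.basis.repr (∑ i, l i • (i : E)) i) ∧
      s.cost ω (∑ i, l i • (i : E)) ≤ ∑ i : V, ω i * l i := by
  obtain ⟨W, b, hW, hb, h1, h2⟩ := exists_basis_repr_nonneg hht hspan ω l hl
  exact ⟨⟨W, hW, b, hb⟩, h1, by rw [cost_apply]; exact h2⟩

theorem exists_isLower_of_ne_zero [FiniteDimensional ℝ E] {ht : E →ₗ[ℝ] ℝ}
    (hht : ∀ v ∈ V, ht v = 1)
    (hspan : Submodule.span ℝ (V : Set E) = ⊤) {ω : E → ℝ}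
    (hω : ∀ s : SubBasis V, ∀ w ∈ V, w ∉ s.carrier → s.cost ω w ≠ ω w) {y : E}
    (hy : y ∈ conicHull V) (hne : ∀ (s : SubBasis V) i, s.basis.repr y i ≠ 0) :
    ∃ s : SubBasis V, s.IsLower ω ∧ ∀ i, 0 < s.basis.repr y i := by
  classical
  obtain ⟨l, hl, rfl⟩ := hy
  set y := ∑ i, l i • (i : E) with hy
  obtain ⟨s₀, hs₀, -⟩ := exists_repr_nonneg hht hspan ω l hl
  let A : Set (SubBasis V) := {s | ∀ i, 0 ≤ s.basis.repr y i}
  obtain ⟨s, hsA, hsmin⟩ := Set.exists_min_image A (fun s => s.cost ω y) A.toFinite ⟨s₀, hs₀⟩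
  have hpos : ∀ i, 0 < s.basis.repr y i := fun i => lt_of_le_of_ne (hsA i) (hne s i).symm
  refine ⟨s, fun w hw hws => lt_of_le_of_ne (not_lt.1 fun hlt => ?_) (hω s w hw hws), hpos⟩
  obtain ⟨δ, hδ, hδpos⟩ := exists_pos_forall_sub_mul_pos Finset.univ (s.basis.repr y)
    (s.basis.repr w) fun i _ => hpos i
  let l' : V → ℝ := fun v => (if hv : (v : E) ∈ s.carrier then
    s.basis.repr y ⟨v, hv⟩ - δ * s.basis.repr w ⟨v, hv⟩ else 0) + if (v : E) = w then δ else 0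
  have hl' : ∀ v, 0 ≤ l' v := fun v => by
    refine add_nonneg ?_ (by split_ifs <;> linarith)
    split_ifs with hv
    · exact (hδpos ⟨v, hv⟩ (Finset.mem_univ _)).le
    · exact le_rfl
  have hsum : ∀ {F : Type} [AddCommGroup F] [Module ℝ F] (f : E → F), ∑ v : V, l' v • f v =
      ∑ i : s.carrier, (s.basis.repr y i - δ * s.basis.repr w i) • f i + δ • f w := by
    intro F _ _ f
    simp only [l', add_smul, Finset.sum_add_distrib]
    congr 1
    · exact sum_dite_mem_smul s.subset (fun i => s.basis.repr y i - δ * s.basis.repr w i) f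
    · rw [Finset.sum_eq_single ⟨w, hw⟩]
      · simp
      · intro v _ hv
        rw [if_neg (fun h => hv (Subtype.ext h)), zero_smul]
      · simp
  have hsumy : ∑ v : V, l' v • (v : E) = y := by
    rw [hsum fun v => v]
    simp only [sub_smul, Finset.sum_sub_distrib, mul_smul, ← Finset.smul_sum]
    have e : ∀ z, ∑ i : s.carrier, s.basis.repr z i • (i : E) = z := fun z => by
      conv_rhs => rw [← s.basis.sum_repr z]
      exact Finset.sum_congr rfl fun i _ => by rw [s.basis_apply]
    rw [e, e, sub_add_cancel]
  have hcost : ∑ v : V, ω v * l' v = s.cost ω y - δ * s.cost ω w + δ * ω w := by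
    have e : ∑ v : V, ω v * l' v = ∑ v : V, l' v • ω v :=
      Finset.sum_congr rfl fun v _ => by rw [smul_eq_mul, mul_comm]
    rw [e, hsum ω, cost_apply, cost_apply, Finset.mul_sum, ← Finset.sum_sub_distrib, smul_eq_mul]
    congr 1
    exact Finset.sum_congr rfl fun i _ => by rw [smul_eq_mul]; ring
  obtain ⟨t, ht1, ht2⟩ := exists_repr_nonneg hht hspan ω l' hl'
  rw [hsumy] at ht1 ht2
  have := hsmin t ht1
  rw [hcost] at ht2
  nlinarith

open Filter Topology in
theorem exists_isLower_of_eventually [FiniteDimensional ℝ E] {ht : E →ₗ[ℝ] ℝ}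
    (hht : ∀ v ∈ V, ht v = 1)
    (hspan : Submodule.span ℝ (V : Set E) = ⊤) {ω : E → ℝ}
    (hω : ∀ s : SubBasis V, ∀ w ∈ V, w ∉ s.carrier → s.cost ω w ≠ ω w) {η : E}
    (hη : ∀ (s : SubBasis V) i, s.basis.repr η i ≠ 0) {y : E}
    (hy : ∀ᶠ ε : ℝ in 𝓝[>] 0, y + ε • η ∈ conicHull V) :
    ∃ s : SubBasis V, s.IsLower ω ∧
      ∀ i, 0 ≤ s.basis.repr y i ∧ (s.basis.repr η i < 0 → 0 < s.basis.repr y i) := by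
  have hne : ∀ᶠ ε : ℝ in 𝓝[>] 0, ∀ (s : SubBasis V) i, s.basis.repr (y + ε • η) i ≠ 0 := by
    refine eventually_all.2 fun s => eventually_all.2 fun i => ?_
    have hr : ∀ ε : ℝ, s.basis.repr (y + ε • η) i =
        s.basis.repr y i + ε * s.basis.repr η i := fun ε => by simp
    simp only [hr]
    by_cases h0 : s.basis.repr y i = 0
    · filter_upwards [self_mem_nhdsWithin] with ε hε
      rw [h0, zero_add]
      exact mul_ne_zero (ne_of_gt hε) (hη s i)
    · have : Tendsto (fun ε : ℝ => s.basis.repr y i + ε * s.basis.repr η i) (𝓝[>] 0)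
          (𝓝 (s.basis.repr y i + 0 * s.basis.repr η i)) :=
        Tendsto.mono_left (Continuous.tendsto (by fun_prop) _) nhdsWithin_le_nhds
      exact this.eventually_ne (by simpa using h0)
  have hex : ∃ᶠ ε : ℝ in 𝓝[>] 0, ∃ s : SubBasis V,
      s.IsLower ω ∧ ∀ i, 0 < s.basis.repr (y + ε • η) i :=
    Eventually.frequently ((hy.and hne).mono fun ε h =>
      exists_isLower_of_ne_zero hht hspan hω h.1 h.2)
  have hex' : ∃ s : SubBasis V, ∃ᶠ ε : ℝ in 𝓝[>] 0,
      s.IsLower ω ∧ ∀ i, 0 < s.basis.repr (y + ε • η) i := by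
    by_contra hcon
    exact hex ((eventually_all.2 fun s => not_frequently.1 fun h => hcon ⟨s, h⟩).mono
      fun ε h ⟨s, hs⟩ => h s hs)
  obtain ⟨s, hs⟩ := hex'
  refine ⟨s, hs.exists.choose_spec.1, fun i => ?_⟩
  have hr : ∀ ε : ℝ, s.basis.repr (y + ε • η) i =
      s.basis.repr y i + ε * s.basis.repr η i := fun ε => by simp
  have h0 : 0 ≤ s.basis.repr y i := by
    by_contra! hlt
    have : Tendsto (fun ε : ℝ => s.basis.repr y i + ε * s.basis.repr η i) (𝓝[>] 0)
        (𝓝 (s.basis.repr y i + 0 * s.basis.repr η i)) :=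
      Tendsto.mono_left (Continuous.tendsto (by fun_prop) _) nhdsWithin_le_nhds
    obtain ⟨ε, hε1, hε2⟩ := (hs.and_eventually
      (this.eventually_lt_const (by simpa using hlt))).exists
    have := hε1.2 i
    rw [hr] at this
    linarith
  refine ⟨h0, fun hη' => ?_⟩
  obtain ⟨ε, hε1, hε2⟩ := (hs.and_eventually self_mem_nhdsWithin).exists
  have := hε1.2 i
  rw [hr] at this
  have : ε * s.basis.repr η i < 0 := mul_neg_of_pos_of_neg hε2 hη'
  linarith

open Classical in
theorem exists_generic_cost (V : Finset E) : ∃ ω : E → ℝ, ∀ s : SubBasis V, ∀ w ∈ V,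
    w ∉ s.carrier → s.cost ω w ≠ ω w := by
  have := Fintype.ofFinite (SubBasis V)
  let form : SubBasis V × V → (V → ℝ) := fun p v =>
    (if v = p.2 then 1 else 0) -
      if hv : (v : E) ∈ p.1.carrier then p.1.basis.repr p.2 ⟨v, hv⟩ else 0
  obtain ⟨μ, -, hμ⟩ := exists_pos_sum_mul_ne_zero
    ((Finset.univ.filter fun p : SubBasis V × V => (p.2 : E) ∉ p.1.carrier).image form) (by
      intro c hc h0
      obtain ⟨p, hp, rfl⟩ := Finset.mem_image.1 hc
      have := congrFun h0 p.2
      simp [form, (Finset.mem_filter.1 hp).2] at this)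
  refine ⟨fun v => if hv : v ∈ V then μ ⟨v, hv⟩ else 0, fun s w hw hws heq => ?_⟩
  refine hμ _ (Finset.mem_image_of_mem form (a := (s, ⟨w, hw⟩)) (by simpa using hws)) ?_
  rw [cost_apply] at heq
  simp only [dif_pos hw] at heq
  simp only [form, sub_mul, Finset.sum_sub_distrib, ite_mul, one_mul, zero_mul,
    Finset.sum_ite_eq', Finset.mem_univ, if_true]
  have e := sum_dite_mem_smul s.subset (s.basis.repr w)
    fun v => if hv : v ∈ V then μ ⟨v, hv⟩ else 0
  simp only [Subtype.coe_eta, Finset.coe_mem, dite_true, smul_eq_mul] at e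
  rw [← heq, sub_eq_zero]
  exact (Finset.sum_congr rfl fun i _ => mul_comm _ _).trans e.symm

theorem exists_generic_interior_point (V : Finset E) (hspan : Submodule.span ℝ (V : Set E) = ⊤) :
    ∃ ξ ∈ conicInterior V, ∀ (s : SubBasis V) i, s.basis.repr ξ i ≠ 0 := by
  classical
  have := Fintype.ofFinite (SubBasis V)
  obtain ⟨μ, hμ0, hμ⟩ := exists_pos_sum_mul_ne_zero
    (Finset.univ.image fun (p : Σ s : SubBasis V, s.carrier) (v : V) =>
      p.1.basis.repr (v : E) p.2) (by
      intro c hc h0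
      obtain ⟨⟨s, i⟩, -, rfl⟩ := Finset.mem_image.1 hc
      have := congrFun h0 ⟨i, s.subset i.2⟩
      simp only [Pi.zero_apply] at this
      rw [← s.basis_apply i] at this
      simp at this)
  refine ⟨∑ v : V, μ v • (v : E), fun p => ?_, fun s i h0 => ?_⟩
  · have hp : p ∈ Submodule.span ℝ (V : Set E) := hspan ▸ Submodule.mem_top
    obtain ⟨c, -, rfl⟩ := Submodule.mem_span_finset.1 hp
    obtain ⟨ε, hε, hpos⟩ := exists_pos_forall_sub_mul_pos Finset.univ μ (fun v : V => c v)
      fun v _ => hμ0 v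
    refine ⟨ε, hε, fun v => μ v - ε * c v, fun v => (hpos v (Finset.mem_univ _)).le, ?_⟩
    simp only [sub_smul, Finset.sum_sub_distrib, mul_smul, ← Finset.smul_sum]
    rw [Finset.sum_coe_sort V fun v => c v • v]
  · refine hμ _ (Finset.mem_image_of_mem _ (Finset.mem_univ ⟨s, i⟩)) ?_
    rw [← h0]
    simp [map_sum, mul_comm]

end SubBasis

/-- The half-open regular triangulations of a cone with respect to a generic interior point and
its opposite. -/
theorem exists_halfOpen_triangulation [FiniteDimensional ℝ E] {V : Finset E} {ht : E →ₗ[ℝ] ℝ}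
    (hht : ∀ v ∈ V, ht v = 1) (hspan : Submodule.span ℝ (V : Set E) = ⊤) (hV : V.Nonempty) :
    ∃ (ι : Type) (_ : Fintype ι) (b : ι → Module.Basis (Fin (Module.finrank ℝ E)) ℝ E)
      (pos : ι → Fin (Module.finrank ℝ E) → Prop),
      (∀ s i, b s i ∈ V) ∧ (∀ s, ∃ i, pos s i) ∧
      (∀ z ∈ conicHull V, ∃! s, ∀ i, 0 ≤ (b s).repr z i ∧ (¬ pos s i → 0 < (b s).repr z i)) ∧
      (∀ s z, (∀ i, 0 ≤ (b s).repr z i ∧ (pos s i → 0 < (b s).repr z i)) →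
        z ∈ conicInterior V) ∧
      ∀ z ∈ conicInterior V, ∃ s, ∀ i, 0 ≤ (b s).repr z i ∧
        (pos s i → 0 < (b s).repr z i) := by
  classical
  obtain ⟨ω, hω⟩ := SubBasis.exists_generic_cost V
  obtain ⟨ξ, hξint, hξ⟩ := SubBasis.exists_generic_interior_point V hspan
  have e : ∀ s : SubBasis V, Nonempty (s.carrier ≃ Fin (Module.finrank ℝ E)) := fun s =>
    ⟨Fintype.equivFinOfCardEq (Module.finrank_eq_card_basis s.basis).symm⟩
  let e' := fun s => (e s).some
  let b : SubBasis V → Module.Basis (Fin (Module.finrank ℝ E)) ℝ E :=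
    fun s => s.basis.reindex (e' s)
  have hb : ∀ s i, b s i ∈ V := fun s i => by
    simp only [b, Module.Basis.reindex_apply]
    exact s.basis_mem _
  have hrep : ∀ s z i, (b s).repr z i = s.basis.repr z ((e' s).symm i) := fun s z i => by
    simp [b]
  have hξ' : ∀ s i, (b s).repr ξ i ≠ 0 := fun s i => by rw [hrep]; exact hξ s _
  have hsmall : ∀ s z (η : E), (∀ i, 0 ≤ (b s).repr z i ∧
      ((b s).repr η i < 0 → 0 < (b s).repr z i)) → (∀ i, (b s).repr η i ≠ 0) →
      ∀ᶠ ε : ℝ in nhdsWithin 0 (Set.Ioi 0), ∀ i, 0 < (b s).repr (z + ε • η) i := by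
    intro s z η hz hη
    refine Filter.eventually_all.2 fun i => ?_
    have hr : ∀ ε : ℝ, (b s).repr (z + ε • η) i = (b s).repr z i - ε * (- (b s).repr η i) :=
      fun ε => by simp
    simp only [hr]
    rcases (hz i).1.lt_or_eq with h | h
    · exact eventually_sub_mul_pos _ _ h
    · have h1 : 0 < (b s).repr η i := lt_of_le_of_ne
        (not_lt.1 fun hlt => ((hz i).2 hlt).ne h) (hη i).symm
      filter_upwards [self_mem_nhdsWithin] with ε hε
      rw [← h]
      have := mul_pos (show (0 : ℝ) < ε from hε) h1
      linarith
  refine ⟨{s : SubBasis V // s.IsLower ω}, Fintype.ofFinite _, fun s => b s,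
    fun s i => 0 < (b s).repr ξ i, fun s => hb s, fun s => ?_, fun z hz => ?_, fun s z hz => ?_,
    fun z hz => ?_⟩
  · by_contra! hcon
    obtain ⟨v, hv⟩ := hV
    obtain ⟨ε, hε, hmem⟩ := hξint v
    have hnonneg : ∀ y ∈ conicHull V, 0 ≤ ht y := by
      rintro _ ⟨l, hl, rfl⟩
      rw [map_sum]
      exact Finset.sum_nonneg fun i _ => by
        rw [map_smul, hht _ i.2, smul_eq_mul, mul_one]; exact hl i
    have h1 := hnonneg _ hmem
    rw [map_sub, map_smul, hht v hv, smul_eq_mul, mul_one] at h1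
    have h2 : ht ξ ≤ 0 := by
      rw [← (b s).sum_repr ξ, map_sum]
      exact Finset.sum_nonpos fun i _ => by
        rw [map_smul, hht _ (hb s i), smul_eq_mul, mul_one]; exact hcon i
    linarith
  · obtain ⟨s, hs, hs'⟩ := SubBasis.exists_isLower_of_eventually hht hspan hω hξ (y := z)
      (Filter.eventually_of_mem self_mem_nhdsWithin fun ε hε => add_mem_conicHull hz
        (smul_mem_conicHull (le_of_lt hε) (mem_conicHull_of_mem_conicInterior hξint)))
    have hcond : ∀ t : {s : SubBasis V // s.IsLower ω}, (∀ i, 0 ≤ (b t).repr z i ∧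
        (¬ 0 < (b t).repr ξ i → 0 < (b t).repr z i)) → ∀ i, 0 ≤ (b t).repr z i ∧
        ((b t).repr ξ i < 0 → 0 < (b t).repr z i) := fun t h i =>
      ⟨(h i).1, fun h' => (h i).2 (not_lt.2 h'.le)⟩
    have hs1 : ∀ i, 0 ≤ (b s).repr z i ∧ (¬ 0 < (b s).repr ξ i → 0 < (b s).repr z i) := fun i => by
      have h1 := hs' ((e' s).symm i)
      rw [← hrep, ← hrep] at h1
      exact ⟨h1.1, fun h' => h1.2 (lt_of_le_of_ne (not_lt.1 h') (hξ' s i))⟩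
    refine ⟨⟨s, hs⟩, hs1, fun t ht => ?_⟩
    obtain ⟨ε, h1, h2⟩ := ((hsmall s z ξ (hcond ⟨s, hs⟩ hs1) (hξ' s)).and
      (hsmall t z ξ (hcond t ht) (hξ' t))).exists
    refine Subtype.ext (t.2.eq_of_repr_pos hs (y := z + ε • ξ) (fun i => ?_) fun i => ?_)
    · have := h2 (e' t i)
      rwa [hrep, Equiv.symm_apply_apply] at this
    · have := h1 (e' s i)
      rwa [hrep, Equiv.symm_apply_apply] at this
  · obtain ⟨ε, h1, hε⟩ := ((hsmall s z (-ξ) (fun i => ⟨(hz i).1, fun h => (hz i).2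
      (by simpa using h)⟩) (fun i => by simpa using hξ' s i)).and self_mem_nhdsWithin).exists
    refine mem_conicInterior_of_sub_smul_mem hξint hε ?_
    rw [sub_eq_add_neg, ← smul_neg, ← (b s).sum_repr (z + ε • -ξ)]
    exact sum_smul_mem_conicHull _ _ _ (fun i _ => (h1 i).le) fun i _ =>
      mem_conicHull_of_mem (hb s i)
  · obtain ⟨ε₀, hε₀, hmem⟩ := hz ξ
    have hzV := mem_conicHull_of_mem_conicInterior hz
    obtain ⟨s, hs, hs'⟩ := SubBasis.exists_isLower_of_eventually hht hspan hω (η := -ξ)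
      (fun s i => by simpa using hξ s i) (y := z) (by
        filter_upwards [Ioo_mem_nhdsGT hε₀] with ε hε
        have : z + ε • -ξ = (1 - ε / ε₀) • z + (ε / ε₀) • (z - ε₀ • ξ) := by
          rw [smul_sub, smul_smul, div_mul_cancel₀ _ hε₀.ne', sub_smul, one_smul, smul_neg]
          abel
        rw [this]
        exact add_mem_conicHull (smul_mem_conicHull
          (sub_nonneg.2 ((div_le_one hε₀).2 hε.2.le)) hzV)
          (smul_mem_conicHull (div_nonneg hε.1.le hε₀.le) hmem))
    refine ⟨⟨s, hs⟩, fun i => ?_⟩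
    have h1 := hs' ((e' s).symm i)
    simp only [map_neg, Finsupp.neg_apply, neg_lt_zero] at h1
    rwa [← hrep, ← hrep] at h1

end Triangulation

theorem eq_of_sum_mul_choose_eq {n : ℕ} {f g : ℕ → ℤ}
    (h : ∀ m : ℕ, ∑ i ∈ Finset.range (n + 1), f i * ((n + m - i).choose n : ℤ) =
      ∑ i ∈ Finset.range (n + 1), g i * ((n + m - i).choose n : ℤ)) :
    ∀ i, i ≤ n → f i = g i := by
  intro m
  induction m using Nat.strong_induction_on with
  | _ m ih =>
    intro hm
    have key : ∀ f : ℕ → ℤ, ∑ i ∈ Finset.range (n + 1), f i * ((n + m - i).choose n : ℤ) =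
        ∑ i ∈ Finset.range m, f i * ((n + m - i).choose n : ℤ) + f m := fun f => by
      rw [← Finset.sum_subset (Finset.range_mono (Nat.succ_le_succ hm)) fun i hi hi' => ?_,
        Finset.sum_range_succ]
      · simp
      · rw [Nat.choose_eq_zero_of_lt, Nat.cast_zero, mul_zero]
        rw [Finset.mem_range] at hi hi'
        omega
    have h1 := h m
    rw [key, key, Finset.sum_congr rfl fun i hi => by
      rw [ih i (Finset.mem_range.1 hi) ((Finset.mem_range.1 hi).le.trans hm)]] at h1
    exact add_left_cancel h1

/-- The half-open unit interval that contains `0` if `p` holds, and `1` otherwise. -/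
def halfOpenInterval (p : Prop) : Set ℝ := {c | (p → 0 ≤ c ∧ c < 1) ∧ (¬ p → 0 < c ∧ c ≤ 1)}

theorem exists_sub_mem_halfOpenInterval (p : Prop) (c : ℝ) :
    ∃ a : ℤ, c - a ∈ halfOpenInterval p := by
  by_cases h : p
  · refine ⟨⌊c⌋, fun _ => ⟨?_, ?_⟩, fun h' => absurd h h'⟩
    · linarith [Int.floor_le c]
    · linarith [Int.lt_floor_add_one c]
  · refine ⟨⌈c⌉ - 1, fun h' => absurd h' h, fun _ => ⟨?_, ?_⟩⟩
    · push_cast; linarith [Int.ceil_lt_add_one c]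
    · push_cast; linarith [Int.le_ceil c]

theorem eq_zero_of_mem_halfOpenInterval {p : Prop} {c : ℝ} {a : ℤ}
    (h : c ∈ halfOpenInterval p) (h' : c - a ∈ halfOpenInterval p) : a = 0 := by
  by_cases hp : p
  · obtain ⟨h1, h2⟩ := h.1 hp
    obtain ⟨h3, h4⟩ := h'.1 hp
    have : (a : ℝ) < 1 := by linarith
    have h5 : (-1 : ℝ) < a := by linarith
    norm_cast at this
    have : (-1 : ℤ) < a := by exact_mod_cast h5
    omega
  · obtain ⟨h1, h2⟩ := h.2 hp
    obtain ⟨h3, h4⟩ := h'.2 hp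
    have : (a : ℝ) < 1 := by linarith
    have h5 : (-1 : ℝ) < a := by linarith
    norm_cast at this
    have : (-1 : ℤ) < a := by exact_mod_cast h5
    omega

section Reciprocity

variable {E : Type} [AddCommGroup E] [Module ℝ E] {N : ℕ}

/-- The points of `M` in a half-open parallelepiped spanned by a basis. -/
def halfOpenBox (M : AddSubgroup E) (b : Module.Basis (Fin N) ℝ E) (pos : Fin N → Prop) : Set E :=
  {p | p ∈ M ∧ ∀ i, b.repr p i ∈ halfOpenInterval (pos i)}

variable {M : AddSubgroup E} {ht : E →ₗ[ℝ] ℝ}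

theorem exists_sub_mem_halfOpenBox (b : Module.Basis (Fin N) ℝ E) (hb : ∀ i, b i ∈ M)
    (pos : Fin N → Prop) {z : E} (hz : z ∈ M) :
    ∃ a : Fin N → ℤ, z - ∑ i, (a i : ℝ) • b i ∈ halfOpenBox M b pos ∧
      ∀ i, b.repr (z - ∑ i, (a i : ℝ) • b i) i = b.repr z i - a i := by
  choose a ha using fun i => exists_sub_mem_halfOpenInterval (pos i) (b.repr z i)
  have h : ∀ i, b.repr (z - ∑ i, (a i : ℝ) • b i) i = b.repr z i - a i := fun i => by
    rw [map_sub, Finsupp.sub_apply, b.repr_sum_self]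
  exact ⟨a, ⟨M.sub_mem hz (sum_intCast_smul_mem hb a), fun i => by rw [h]; exact ha i⟩, h⟩

theorem repr_nonneg_of_mem_halfOpenBox {b : Module.Basis (Fin N) ℝ E} {pos : Fin N → Prop} {p : E}
    (hp : p ∈ halfOpenBox M b pos) (i : Fin N) :
    0 ≤ b.repr p i ∧ (¬ pos i → 0 < b.repr p i) := by
  refine ⟨?_, fun h => ((hp.2 i).2 h).1⟩
  by_cases h : pos i
  · exact ((hp.2 i).1 h).1
  · exact ((hp.2 i).2 h).1.le

theorem repr_le_one_of_mem_halfOpenBox {b : Module.Basis (Fin N) ℝ E} {pos : Fin N → Prop} {p : E}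
    (hp : p ∈ halfOpenBox M b pos) (i : Fin N) :
    b.repr p i ≤ 1 ∧ (pos i → b.repr p i < 1) := by
  refine ⟨?_, fun h => ((hp.2 i).1 h).2⟩
  by_cases h : pos i
  · exact ((hp.2 i).1 h).2.le
  · exact ((hp.2 i).2 h).2

theorem exists_natCast_eq_ht_of_mem_halfOpenBox (hint : ∀ z ∈ M, ht z ∈ realIntegers)
    {b : Module.Basis (Fin N) ℝ E} (hb : ∀ i, ht (b i) = 1) {pos : Fin N → Prop}
    (hpos : ∃ i, pos i) {p : E} (hp : p ∈ halfOpenBox M b pos) :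
    ∃ j : ℕ, j < N ∧ ht p = j := by
  obtain ⟨a, ha⟩ := hint p hp.1
  have h1 : (a : ℝ) = ht p := ha
  have h0 : 0 ≤ ht p := by
    rw [ht_eq_sum_repr hb]
    exact Finset.sum_nonneg fun i _ => (repr_nonneg_of_mem_halfOpenBox hp i).1
  have h2 : ht p < N := by
    rw [ht_eq_sum_repr hb]
    obtain ⟨i, hi⟩ := hpos
    calc ∑ i, b.repr p i < ∑ _i : Fin N, (1 : ℝ) :=
          Finset.sum_lt_sum (fun i _ => (repr_le_one_of_mem_halfOpenBox hp i).1)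
            ⟨i, Finset.mem_univ i, (repr_le_one_of_mem_halfOpenBox hp i).2 hi⟩
      _ = N := by simp
  rw [← h1] at h0 h2
  lift a to ℕ using by exact_mod_cast h0
  exact ⟨a, by exact_mod_cast h2, by rw [← h1]; simp⟩

open Classical in
/-- The number of points of `M` at height `m` in a half-open cone with a given residue in the
half-open parallelepiped. -/
theorem card_image_add_sum {b : Module.Basis (Fin N) ℝ E} (p : E) (l : ℕ) :
    ((Finset.finsuppAntidiag (Finset.univ : Finset (Fin N)) l).image
      fun ν => p + ∑ i, (ν i : ℝ) • b i).card = (N + l - 1).choose l := by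
  rw [Finset.card_image_of_injective, Finset.card_finsuppAntidiag_nat_eq_choose, Finset.card_univ,
    Fintype.card_fin]
  intro ν ν' h
  have h := add_left_cancel h
  ext i
  have := congrArg (fun z => b.repr z i) h
  simp only [b.repr_sum_self] at this
  exact_mod_cast this

theorem exists_isMinimalInteriorPoint [FiniteDimensional ℝ E] {V : Finset E} {n d k : ℕ}
    (hht : ∀ v ∈ V, ht v = 1) (hVM : ∀ v ∈ V, v ∈ M)
    (hspan : Submodule.span ℝ (V : Set E) = ⊤) (hint : ∀ z ∈ M, ht z ∈ realIntegers)
    (hV : V.Nonempty) (hn : Module.finrank ℝ E = n + 1) (h : ℕ → ℤ)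
    (hfin : ∀ m : ℕ, {z | z ∈ M ∧ ht z = m ∧ z ∈ conicHull V}.Finite)
    (hcount : ∀ m : ℕ, ({z | z ∈ M ∧ ht z = m ∧ z ∈ conicHull V}.ncard : ℤ) =
      ∑ i ∈ Finset.range (n + 1), h i * ((n + m - i).choose n : ℤ))
    (hdn : d ≤ n) (hd : ∀ i, d < i → h i = 0) (hk : h d = k) (hk0 : k ≠ 0) :
    ∃ x, IsMinimalInteriorPoint M V ht d k x := by
  classical
  obtain ⟨ι, _, b, pos, hbV, hpos, hunique, hintr, hopp⟩ :=
    exists_halfOpen_triangulation hht hspan hV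
  have hb1 : ∀ s i, ht (b s i) = 1 := fun s i => hht _ (hbV s i)
  have hbM : ∀ s i, b s i ∈ M := fun s i => hVM _ (hbV s i)
  have hhull : ∀ s z, (∀ i, 0 ≤ (b s).repr z i) → z ∈ conicHull V := fun s z hz => by
    rw [← (b s).sum_repr z]
    exact sum_smul_mem_conicHull _ _ _ (fun i _ => hz i) fun i _ => mem_conicHull_of_mem (hbV s i)
  let T : Set (ι × E) := {q | q.2 ∈ halfOpenBox M (b q.1) (pos q.1)}
  have hTht : ∀ q ∈ T, ∃ j : ℕ, j < n + 1 ∧ ht q.2 = j := fun q hq => by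
    rw [← hn]
    exact exists_natCast_eq_ht_of_mem_halfOpenBox hint (hb1 q.1) (hpos q.1) hq
  have hTfin : T.Finite := by
    refine ((Set.toFinite (Set.univ : Set ι)).prod ((Finset.range (n + 1)).finite_toSet.biUnion
      fun m _ => hfin m)).subset fun q hq => ⟨trivial, ?_⟩
    obtain ⟨j, hj, hj'⟩ := hTht q hq
    exact Set.mem_biUnion (Finset.mem_coe.2 (Finset.mem_range.2 hj)) ⟨hq.1, hj',
      hhull _ _ fun i => (repr_nonneg_of_mem_halfOpenBox hq i).1⟩
  let β : ℕ → Finset (ι × E) := fun j => hTfin.toFinset.filter fun q => ht q.2 = j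
  have hβ : ∀ j q, q ∈ β j ↔ q ∈ T ∧ ht q.2 = j := fun j q => by simp [β]
  -- decomposition of points of the cone
  have hdec : ∀ z ∈ M, z ∈ conicHull V → ∃ q ∈ T, (∀ i, 0 ≤ (b q.1).repr z i ∧
      (¬ pos q.1 i → 0 < (b q.1).repr z i)) ∧
      ∃ ν : Fin (Module.finrank ℝ E) → ℕ, z = q.2 + ∑ i, (ν i : ℝ) • b q.1 i := by
    intro z hz hzV
    obtain ⟨s, hs, -⟩ := hunique z hzV
    obtain ⟨a, ha, ha'⟩ := exists_sub_mem_halfOpenBox (b s) (hbM s) (pos s) hz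
    have ha0 : ∀ i, 0 ≤ a i := fun i => by
      by_contra! hneg
      have h1 : (a i : ℝ) ≤ -1 := by exact_mod_cast Int.le_sub_one_of_lt hneg
      have h2 := repr_le_one_of_mem_halfOpenBox ha i
      rw [ha'] at h2
      have h3 := hs i
      by_cases hp : pos s i
      · linarith [h2.2 hp]
      · linarith [h3.2 hp]
    refine ⟨(s, _), ha, hs, fun i => (a i).toNat, ?_⟩
    have : ∀ i, (((a i).toNat : ℕ) : ℝ) = a i := fun i => by
      exact_mod_cast Int.toNat_of_nonneg (ha0 i)
    simp only [this, sub_add_cancel]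
  have hreprq : ∀ (q : ι × E) (ν : Fin (Module.finrank ℝ E) → ℕ) i,
      (b q.1).repr (q.2 + ∑ i, (ν i : ℝ) • b q.1 i) i = (b q.1).repr q.2 i + ν i :=
    fun q ν i => by rw [map_add, Finsupp.add_apply, (b q.1).repr_sum_self]
  have hcone : ∀ q ∈ T, ∀ ν : Fin (Module.finrank ℝ E) → ℕ, ∀ i,
      0 ≤ (b q.1).repr (q.2 + ∑ i, (ν i : ℝ) • b q.1 i) i ∧
      (¬ pos q.1 i → 0 < (b q.1).repr (q.2 + ∑ i, (ν i : ℝ) • b q.1 i) i) := by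
    intro q hq ν i
    rw [hreprq]
    have := repr_nonneg_of_mem_halfOpenBox hq i
    exact ⟨add_nonneg this.1 (Nat.cast_nonneg _),
      fun hp => add_pos_of_pos_of_nonneg (this.2 hp) (Nat.cast_nonneg _)⟩
  have hht_add : ∀ (q : ι × E) (ν : Fin (Module.finrank ℝ E) → ℕ),
      ht (q.2 + ∑ i, (ν i : ℝ) • b q.1 i) = ht q.2 + ((∑ i, ν i : ℕ) : ℝ) := fun q ν => by
    simp [hb1]
  have hcard : ∀ m : ℕ, ({z | z ∈ M ∧ ht z = m ∧ z ∈ conicHull V}.ncard : ℤ) =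
      ∑ i ∈ Finset.range (n + 1), ((β i).card : ℤ) * ((n + m - i).choose n : ℤ) := by
    intro m
    let G : ι × E → Finset E := fun q =>
      (hfin m).toFinset.filter fun z => ∃ ν : Fin (Module.finrank ℝ E) → ℕ,
        z = q.2 + ∑ i, (ν i : ℝ) • b q.1 i
    have hA : (hfin m).toFinset = hTfin.toFinset.biUnion G := by
      ext z
      simp only [Set.Finite.mem_toFinset, Finset.mem_biUnion, G, Finset.mem_filter]
      constructor
      · intro hz
        obtain ⟨q, hq, -, ν, hν⟩ := hdec z hz.1 hz.2.2
        exact ⟨q, hq, hz, ν, hν⟩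
      · rintro ⟨q, -, hz, -⟩
        exact hz
    have hdisj : (hTfin.toFinset : Set (ι × E)).PairwiseDisjoint G := by
      intro q hq q' hq' hne
      rw [Function.onFun, Finset.disjoint_left]
      intro z hz hz'
      obtain ⟨hzA, ν, rfl⟩ := Finset.mem_filter.1 hz
      obtain ⟨-, ν', hν⟩ := Finset.mem_filter.1 hz'
      have hqT : q ∈ T := by simpa using hq
      have hqT' : q' ∈ T := by simpa using hq'
      have hs : q.1 = q'.1 := by
        refine (hunique _ ((hfin m).mem_toFinset.1 hzA).2.2).unique (hcone q hqT ν) ?_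
        rw [hν]
        exact hcone q' hqT' ν'
      obtain ⟨s, p⟩ := q
      obtain ⟨s', p'⟩ := q'
      obtain rfl : s = s' := hs
      refine hne (Prod.ext rfl ((b s).ext_elem fun i => ?_))
      have h1 := hreprq (s, p) ν i
      rw [hν, hreprq (s, p') ν' i] at h1
      have h2 : (b s).repr p i - (((ν' i : ℤ) - ν i : ℤ) : ℝ) = (b s).repr p' i := by
        push_cast
        linarith
      have h3 := hqT'.2 i
      rw [← h2] at h3
      rw [← h2, eq_zero_of_mem_halfOpenInterval (hqT.2 i) h3, Int.cast_zero, sub_zero]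
    have hG : ∀ j ∈ Finset.range (n + 1), ∀ q ∈ β j, (G q).card = (n + m - j).choose n := by
      intro j hj q hq
      obtain ⟨hqT, hqj⟩ := (hβ j q).1 hq
      have hmem : ∀ z, z ∈ G q ↔ ∃ ν : Fin (Module.finrank ℝ E) → ℕ, j + ∑ i, ν i = m ∧
          q.2 + ∑ i, (ν i : ℝ) • b q.1 i = z := by
        intro z
        simp only [G, Finset.mem_filter, Set.Finite.mem_toFinset, Set.mem_ofPred_eq]
        constructor
        · rintro ⟨⟨-, hz, -⟩, ν, rfl⟩
          rw [hht_add, hqj] at hz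
          exact ⟨ν, by exact_mod_cast hz, rfl⟩
        · rintro ⟨ν, hν, rfl⟩
          refine ⟨⟨M.add_mem hqT.1 (M.sum_mem fun i _ => ?_), ?_, ?_⟩, ν, rfl⟩
          · rw [Nat.cast_smul_eq_nsmul]
            exact M.nsmul_mem (hbM q.1 i) _
          · rw [hht_add, hqj]; exact_mod_cast hν
          · exact hhull q.1 _ fun i => (hcone q hqT ν i).1
      by_cases hjm : j ≤ m
      · have : G q = (Finset.finsuppAntidiag (Finset.univ : Finset (Fin _)) (m - j)).image
            fun ν => q.2 + ∑ i, (ν i : ℝ) • b q.1 i := by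
          ext z
          rw [hmem, Finset.mem_image]
          constructor
          · rintro ⟨ν, hν, rfl⟩
            exact ⟨Finsupp.equivFunOnFinite.symm ν, by simp; omega, rfl⟩
          · rintro ⟨ν, hν, rfl⟩
            have hν' : ∑ i, ν i = m - j := (Finset.mem_finsuppAntidiag.1 hν).1
            exact ⟨ν, by omega, rfl⟩
        rw [this, card_image_add_sum, hn, Nat.choose_symm_of_eq_add (b := n) (by omega)]
        congr 1
        omega
      · rw [Nat.choose_eq_zero_of_lt (by rw [Finset.mem_range] at hj; omega), Finset.card_eq_zero,
          Finset.eq_empty_iff_forall_notMem]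
        intro z hz
        obtain ⟨ν, hν, -⟩ := (hmem z).1 hz
        omega
    rw [Set.ncard_eq_toFinset_card _ (hfin m), hA, Finset.card_biUnion hdisj]
    have hT : hTfin.toFinset = (Finset.range (n + 1)).biUnion β := by
      ext q
      simp only [Set.Finite.mem_toFinset, Finset.mem_biUnion, hβ, Finset.mem_range]
      exact ⟨fun hq => (hTht q hq).imp fun j hj => ⟨hj.1, hq, hj.2⟩, fun ⟨_, _, hq, _⟩ => hq⟩
    rw [hT, Finset.sum_biUnion]
    · push_cast
      refine Finset.sum_congr rfl fun j hj => ?_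
      rw [Finset.sum_congr rfl fun q hq => by rw [hG j hj q hq]]
      simp
    · intro i _ j _ hij
      rw [Function.onFun, Finset.disjoint_left]
      intro q hq hq'
      have := ((hβ i q).1 hq).2.symm.trans ((hβ j q).1 hq').2
      exact hij (by exact_mod_cast this)
  have hβh : ∀ i, i ≤ n → ((β i).card : ℤ) = h i :=
    eq_of_sum_mul_choose_eq fun m => (hcard m).symm.trans (hcount m)
  have hTd : ∀ q ∈ T, ht q.2 ≤ d := by
    intro q hq
    obtain ⟨j, hj, hqj⟩ := hTht q hq
    rw [hqj]
    by_contra! hlt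
    have h1 := hβh j (by omega)
    rw [hd j (by exact_mod_cast hlt)] at h1
    have h2 : q ∈ β j := (hβ j q).2 ⟨hq, hqj⟩
    have h3 : (β j).card = 0 := by exact_mod_cast h1
    rw [Finset.card_eq_zero.1 h3] at h2
    simp at h2
  have hβd : (β d).card = k := by
    have := hβh d hdn
    rw [hk] at this
    exact_mod_cast this
  have hsum1 : ∀ s, ht (∑ i, b s i) = Module.finrank ℝ E := fun s => by simp [hb1]
  have hcompl : ∀ s z i, (b s).repr (∑ i, b s i - z) i = 1 - (b s).repr z i := fun s z i => by
    rw [map_sub, Finsupp.sub_apply]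
    congr 1
    simp
  have hcomplM : ∀ s z, z ∈ M → ∑ i, b s i - z ∈ M := fun s z hz =>
    M.sub_mem (M.sum_mem fun i _ => hbM s i) hz
  -- interior points have complements dominated by box points
  have hinterior : ∀ y ∈ M, y ∈ conicInterior V → ∃ s, ∃ a : Fin (Module.finrank ℝ E) → ℤ,
      (∀ i, a i ≤ 0) ∧ (s, ∑ i, b s i - y - ∑ i, (a i : ℝ) • b s i) ∈ T := by
    intro y hy hyV
    obtain ⟨s, hs⟩ := hopp y hyV
    obtain ⟨a, ha, ha'⟩ := exists_sub_mem_halfOpenBox (b s) (hbM s) (pos s) (hcomplM s y hy)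
    refine ⟨s, a, fun i => ?_, ha⟩
    by_contra! hpos'
    have h1 : (1 : ℝ) ≤ a i := by exact_mod_cast hpos'
    have h2 := repr_nonneg_of_mem_halfOpenBox ha i
    rw [ha', hcompl] at h2
    have h3 := hs i
    by_cases hp : pos s i
    · linarith [h3.2 hp]
    · linarith [h2.2 hp]
  have hht_sub : ∀ s y (a : Fin (Module.finrank ℝ E) → ℤ),
      ht (∑ i, b s i - y - ∑ i, (a i : ℝ) • b s i) =
        Module.finrank ℝ E - ht y - ((∑ i, a i : ℤ) : ℝ) := fun s y a => by
    rw [map_sub, map_sub, hsum1]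
    simp [hb1]
  obtain ⟨⟨s, p⟩, hq⟩ : (β d).Nonempty := Finset.card_pos.1 (by omega)
  obtain ⟨hqT, hqd⟩ := (hβ _ _).1 hq
  refine ⟨∑ i, b s i - p, hht, hVM, hspan, hint, fun y hy hyV => ?_, hcomplM s p hqT.1,
    hintr s _ fun i => ?_, by rw [map_sub, hsum1, hqd], fun z hz hz0 hprog => ?_⟩
  · obtain ⟨s', a, ha, hT'⟩ := hinterior y hy hyV
    have h1 := hTd _ hT'
    rw [hht_sub] at h1
    have h2 : ((∑ i, a i : ℤ) : ℝ) ≤ 0 := by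
      exact_mod_cast Finset.sum_nonpos fun i _ => ha i
    linarith
  · rw [hcompl]
    have h1 := repr_le_one_of_mem_halfOpenBox hqT i
    exact ⟨sub_nonneg.2 h1.1, fun hp => sub_pos.2 (h1.2 hp)⟩
  · by_contra hzne
    set x := ∑ i, b s i - p with hx
    have hxM : x ∈ M := hcomplM s p hqT.1
    have hmem : ∀ t : ℕ, t ≤ k → ∃ s', (s', ∑ i, b s' i - (x + (t : ℝ) • z)) ∈ β d := by
      intro t ht'
      have htM : x + (t : ℝ) • z ∈ M := M.add_mem hxM (by
        rw [Nat.cast_smul_eq_nsmul]; exact M.nsmul_mem hz t)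
      obtain ⟨s', a, ha, hT'⟩ := hinterior _ htM (hprog t ht')
      have hxt : ht (x + (t : ℝ) • z) = Module.finrank ℝ E - d := by
        rw [map_add, map_smul, hz0, smul_zero, add_zero, hx, map_sub, hsum1, hqd]
      have h1 := hTd _ hT'
      rw [hht_sub, hxt] at h1
      have h2 : 0 ≤ ∑ i, a i := by
        have : (0 : ℝ) ≤ ((∑ i, a i : ℤ) : ℝ) := by linarith
        exact_mod_cast this
      have h3 : ∀ i, a i = 0 := fun i =>
        (Finset.sum_eq_zero_iff_of_nonpos fun i _ => ha i).1
          (le_antisymm (Finset.sum_nonpos fun i _ => ha i) h2) i (Finset.mem_univ i)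
      simp only [h3, Int.cast_zero, zero_smul, Finset.sum_const_zero, sub_zero] at hT'
      refine ⟨s', (hβ _ _).2 ⟨hT', ?_⟩⟩
      simp only
      rw [map_sub, hsum1, hxt]
      ring
    have : Nonempty ι := ⟨s⟩
    choose! f hf using hmem
    have hle := Finset.card_le_card_of_injOn (s := Finset.range (k + 1)) (t := β d)
      (fun t => (f t, ∑ i, b (f t) i - (x + (t : ℝ) • z)))
      (fun t ht' => hf t (Nat.lt_succ_iff.1 (Finset.mem_range.1 ht'))) (by
        intro t _ t' _ heq
        obtain ⟨h1, h2⟩ := Prod.ext_iff.1 heq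
        simp only at h1 h2
        rw [h1] at h2
        have h3 := smul_left_injective ℝ hzne (add_left_cancel (sub_right_injective h2))
        exact_mod_cast h3)
    rw [hβd, Finset.card_range] at hle
    omega

end Reciprocity

section Homogenization

variable {n : ℕ}

/-- The lattice `ℤ^n × ℤ` in the homogenization `ℝ^n × ℝ`. -/
def homogeneousLattice (n : ℕ) : AddSubgroup ((Fin n → ℝ) × ℝ) where
  carrier := {z | (∀ i, z.1 i ∈ realIntegers) ∧ z.2 ∈ realIntegers}
  zero_mem' := ⟨fun _ => zero_mem _, zero_mem _⟩
  add_mem' ha hb := ⟨fun i => add_mem (ha.1 i) (hb.1 i), add_mem ha.2 hb.2⟩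
  neg_mem' ha := ⟨fun i => neg_mem (ha.1 i), neg_mem ha.2⟩

theorem mem_homogeneousLattice {z : (Fin n → ℝ) × ℝ} :
    z ∈ homogeneousLattice n ↔ (∀ i, z.1 i ∈ realIntegers) ∧ z.2 ∈ realIntegers := Iff.rfl

theorem isLatticePoint_iff {v : Fin n → ℝ} : IsLatticePoint v ↔ ∀ i, v i ∈ realIntegers :=
  forall_congr' fun _ => ⟨fun ⟨z, hz⟩ => ⟨z, hz.symm⟩, fun ⟨z, hz⟩ => ⟨z, hz.symm⟩⟩

theorem isLatticePoint_iff_mem_homogeneousLattice {v : Fin n → ℝ} :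
    IsLatticePoint v ↔ (v, (1 : ℝ)) ∈ homogeneousLattice n := by
  rw [isLatticePoint_iff, mem_homogeneousLattice]
  exact ⟨fun h => ⟨h, 1, by simp⟩, fun h => h.1⟩

open Classical in
/-- The finite set `V × {1}`. -/
def homogeneousPoints (V : Finset (Fin n → ℝ)) : Finset ((Fin n → ℝ) × ℝ) :=
  V.image fun v => (v, 1)

theorem mem_homogeneousPoints {V : Finset (Fin n → ℝ)} {z : (Fin n → ℝ) × ℝ} :
    z ∈ homogeneousPoints V ↔ ∃ v ∈ V, (v, 1) = z := by
  classical
  exact Finset.mem_image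

theorem mem_conicHull_homogeneousPoints {V : Finset (Fin n → ℝ)} {p : Fin n → ℝ} {t : ℝ} :
    (p, t) ∈ conicHull (homogeneousPoints V) ↔ ∃ l : (Fin n → ℝ) → ℝ, (∀ v ∈ V, 0 ≤ l v) ∧
      ∑ v ∈ V, l v • v = p ∧ ∑ v ∈ V, l v = t := by
  classical
  constructor
  · rintro ⟨l, hl, h⟩
    have hmem : ∀ v ∈ V, (v, (1 : ℝ)) ∈ homogeneousPoints V := fun v hv =>
      mem_homogeneousPoints.2 ⟨v, hv, rfl⟩
    let l' : (Fin n → ℝ) × ℝ → ℝ := fun z =>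
      if hz : z ∈ homogeneousPoints V then l ⟨z, hz⟩ else 0
    have h' : ∑ v ∈ V, l' (v, 1) • (v, (1 : ℝ)) = (p, t) := by
      rw [← h, ← Finset.sum_image (s := V) (g := fun v => (v, (1 : ℝ))) (f := fun z => l' z • z)
        (fun v _ w _ h => (Prod.ext_iff.1 h).1)]
      rw [← Finset.sum_coe_sort]
      exact Finset.sum_congr rfl fun i _ => by
        rw [show l' i = l i from dif_pos i.2]
    refine ⟨fun v => l' (v, 1), fun v hv => ?_, ?_, ?_⟩
    · simp only [l', dif_pos (hmem v hv)]
      exact hl _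
    · simpa [Prod.fst_sum] using congrArg Prod.fst h'
    · simpa [Prod.snd_sum] using congrArg Prod.snd h'
  · rintro ⟨l, hl, rfl, rfl⟩
    have : (∑ v ∈ V, l v • v, ∑ v ∈ V, l v) = ∑ v ∈ V, l v • (v, (1 : ℝ)) := by
      ext <;> simp [Prod.fst_sum, Prod.snd_sum]
    rw [this]
    exact sum_smul_mem_conicHull _ _ _ hl fun v hv =>
      mem_conicHull_of_mem (mem_homogeneousPoints.2 ⟨v, hv, rfl⟩)

theorem mem_conicHull_homogeneousPoints_iff_mem_smul {V : Finset (Fin n → ℝ)} (hV : V.Nonempty)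
    {p : Fin n → ℝ} {t : ℝ} (ht : 0 ≤ t) :
    (p, t) ∈ conicHull (homogeneousPoints V) ↔ p ∈ t • convexHull ℝ (V : Set (Fin n → ℝ)) := by
  rw [mem_conicHull_homogeneousPoints, Set.mem_smul_set]
  rcases ht.eq_or_lt with rfl | ht
  · constructor
    · rintro ⟨l, hl, rfl, h⟩
      obtain ⟨v, hv⟩ := hV
      refine ⟨v, subset_convexHull ℝ _ hv, ?_⟩
      rw [zero_smul, Finset.sum_eq_zero fun w hw => ?_]
      rw [(Finset.sum_eq_zero_iff_of_nonneg hl).1 h w hw, zero_smul]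
    · rintro ⟨q, -, rfl⟩
      exact ⟨0, by simp, by simp, by simp⟩
  · constructor
    · rintro ⟨l, hl, rfl, h⟩
      refine ⟨t⁻¹ • ∑ v ∈ V, l v • v, Finset.mem_convexHull'.2 ⟨fun v => t⁻¹ * l v,
        fun v hv => mul_nonneg (inv_nonneg.2 ht.le) (hl v hv), ?_, ?_⟩, smul_inv_smul₀ ht.ne' _⟩
      · rw [← Finset.mul_sum, h, inv_mul_cancel₀ ht.ne']
      · rw [Finset.smul_sum]
        exact Finset.sum_congr rfl fun v _ => mul_smul _ _ _
    · rintro ⟨q, hq, rfl⟩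
      obtain ⟨w, hw, hw1, rfl⟩ := Finset.mem_convexHull'.1 hq
      refine ⟨fun v => t * w v, fun v hv => mul_nonneg ht.le (hw v hv), ?_, ?_⟩
      · rw [Finset.smul_sum]
        exact Finset.sum_congr rfl fun v _ => mul_smul _ _ _
      · rw [← Finset.mul_sum, hw1, mul_one]

theorem span_homogeneousPoints {V : Finset (Fin n → ℝ)} (hV : V.Nonempty)
    (h : affineSpan ℝ (convexHull ℝ (V : Set (Fin n → ℝ))) = ⊤) :
    Submodule.span ℝ (homogeneousPoints V : Set ((Fin n → ℝ) × ℝ)) = ⊤ := by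
  obtain ⟨v₀, hv₀⟩ := hV
  rw [affineSpan_convexHull] at h
  have hmem : ∀ v ∈ V, (v, (1 : ℝ)) ∈
      Submodule.span ℝ (homogeneousPoints V : Set ((Fin n → ℝ) × ℝ)) := fun v hv =>
    Submodule.subset_span (Finset.mem_coe.2 (mem_homogeneousPoints.2 ⟨v, hv, rfl⟩))
  have h1 : (⊤ : Submodule ℝ (Fin n → ℝ)) ≤
      (Submodule.span ℝ (homogeneousPoints V : Set ((Fin n → ℝ) × ℝ))).comap
        (LinearMap.inl ℝ (Fin n → ℝ) ℝ) := by
    rw [← AffineSubspace.direction_top ℝ (Fin n → ℝ) (Fin n → ℝ), ← h, direction_affineSpan,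
      vectorSpan_def, Submodule.span_le]
    rintro _ ⟨v, hv, w, hw, rfl⟩
    have := Submodule.sub_mem _ (hmem v hv) (hmem w hw)
    simpa using this
  rw [Submodule.eq_top_iff']
  rintro ⟨p, t⟩
  have h2 := Submodule.add_mem _ (Submodule.mem_comap.1 (h1 (x := p - t • v₀) trivial))
    (Submodule.smul_mem _ t (hmem v₀ hv₀))
  simpa using h2

theorem finite_latticePoints {A : Set (Fin n → ℝ)} (hA : Bornology.IsBounded A) :
    {z : Fin n → ℤ | (fun i => (z i : ℝ)) ∈ A}.Finite := by
  obtain ⟨R, hR⟩ := hA.subset_closedBall 0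
  refine (Set.finite_Icc (fun _ => -⌈R⌉ : Fin n → ℤ) fun _ => ⌈R⌉).subset fun z hz => ?_
  have h1 : ∀ i, |(z i : ℝ)| ≤ R := fun i => by
    have h2 := hR hz
    rw [mem_closedBall_zero_iff] at h2
    exact (norm_le_pi_norm (fun i => (z i : ℝ)) i).trans h2
  have h3 : ∀ i, |z i| ≤ ⌈R⌉ := fun i => by
    exact_mod_cast (h1 i).trans (Int.le_ceil R)
  exact ⟨fun i => (abs_le.1 (h3 i)).1, fun i => (abs_le.1 (h3 i)).2⟩

theorem image_latticePoints {V : Finset (Fin n → ℝ)} (hV : V.Nonempty) (m : ℕ) :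
    {z | z ∈ homogeneousLattice n ∧ LinearMap.snd ℝ (Fin n → ℝ) ℝ z = m ∧
      z ∈ conicHull (homogeneousPoints V)} = (fun (z : Fin n → ℤ) => ((fun i => (z i : ℝ)), (m : ℝ))) ''
        {z : Fin n → ℤ | (fun i => (z i : ℝ)) ∈ (m : ℝ) • convexHull ℝ (V : Set (Fin n → ℝ))} := by
  ext ⟨p, t⟩
  constructor
  · rintro ⟨⟨h1, -⟩, h2, h3⟩
    obtain rfl : t = m := h2
    choose z hz using h1
    obtain rfl : (fun i => (z i : ℝ)) = p := funext hz
    exact ⟨z, (mem_conicHull_homogeneousPoints_iff_mem_smul hV (Nat.cast_nonneg m)).1 h3, rfl⟩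
  · rintro ⟨z, hz, h⟩
    obtain ⟨rfl, rfl⟩ := Prod.ext_iff.1 h
    exact ⟨⟨fun i => ⟨z i, rfl⟩, m, by simp⟩, rfl,
      (mem_conicHull_homogeneousPoints_iff_mem_smul hV (Nat.cast_nonneg m)).2 hz⟩

theorem injective_intCast_prodMk (t : ℝ) :
    Function.Injective fun (z : Fin n → ℤ) => ((fun i => (z i : ℝ)), t) := fun z w h => by
  funext i
  exact Int.cast_injective (congrFun (Prod.ext_iff.1 h).1 i)

theorem exists_isMinimalInteriorPoint_homogeneousPoints {V : Finset (Fin n → ℝ)}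
    (hV : V.Nonempty) (hVL : ∀ v ∈ V, IsLatticePoint v)
    (htop : affineSpan ℝ (convexHull ℝ (V : Set (Fin n → ℝ))) = ⊤) {h : Polynomial ℤ}
    (hh : IsHStarPoly (convexHull ℝ (V : Set (Fin n → ℝ))) h) {d k : ℕ} (hd : h.natDegree = d)
    (hk : h.coeff d = k) :
    ∃ x, IsMinimalInteriorPoint (homogeneousLattice n) (homogeneousPoints V)
      (LinearMap.snd ℝ (Fin n → ℝ) ℝ) d k x := by
  have hfin : ∀ m : ℕ, {z : Fin n → ℤ | (fun i => (z i : ℝ)) ∈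
      (m : ℝ) • convexHull ℝ (V : Set (Fin n → ℝ))}.Finite := fun m =>
    finite_latticePoints ((isBounded_convexHull.2 V.finite_toSet.isBounded).smul₀ _)
  refine exists_isMinimalInteriorPoint (n := n) (fun v hv => ?_) (fun v hv => ?_)
    (span_homogeneousPoints hV htop) (fun z hz => hz.2) ?_ (by simp) h.coeff (fun m => ?_)
    (fun m => ?_) (hd ▸ hh.1) (fun i hi => Polynomial.coeff_eq_zero_of_natDegree_lt (hd ▸ hi)) hk ?_
  · obtain ⟨w, -, rfl⟩ := mem_homogeneousPoints.1 hv
    rfl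
  · obtain ⟨w, hw, rfl⟩ := mem_homogeneousPoints.1 hv
    exact isLatticePoint_iff_mem_homogeneousLattice.1 (hVL w hw)
  · obtain ⟨v, hv⟩ := hV
    exact ⟨_, mem_homogeneousPoints.2 ⟨v, hv, rfl⟩⟩
  · rw [image_latticePoints hV]
    exact (hfin m).image _
  · rw [image_latticePoints hV, Set.ncard_image_of_injective _ (injective_intCast_prodMk _)]
    exact hh.2.2 m
  · rintro rfl
    have h0 : h = 0 := by
      rw [← Polynomial.leadingCoeff_eq_zero, Polynomial.leadingCoeff, hd, hk]
      rfl
    have h1 := hh.2.2 0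
    rw [h0] at h1
    simp only [Polynomial.coeff_zero, zero_mul, Finset.sum_const_zero] at h1
    have h2 := (Set.ncard_eq_zero (hfin 0)).1 (by exact_mod_cast h1)
    obtain ⟨v, hv⟩ := hV
    refine (Set.eq_empty_iff_forall_notMem.1 h2 0) ⟨v, subset_convexHull ℝ _ hv, ?_⟩
    ext i
    simp

end Homogenization

section Datum

variable {φ n m : ℕ}

/-- The projection from the homogenization of a pyramid along its apex. -/
def apexProjection (n : ℕ) : (Fin (n + 1) → ℝ) × ℝ →ₗ[ℝ] (Fin n → ℝ) × ℝ where
  toFun z := (fun i => z.1 i.castSucc, z.2 - z.1 (Fin.last n))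
  map_add' z w := by
    ext <;> simp
    ring
  map_smul' c z := by
    ext <;> simp
    ring

theorem mem_homogeneousLattice_succ {z : (Fin (n + 1) → ℝ) × ℝ} :
    z ∈ homogeneousLattice (n + 1) ↔
      apexProjection n z ∈ homogeneousLattice n ∧ z.1 (Fin.last n) ∈ realIntegers := by
  simp only [mem_homogeneousLattice, Fin.forall_fin_succ', apexProjection, LinearMap.coe_mk,
    AddHom.coe_mk]
  constructor
  · rintro ⟨⟨h1, h2⟩, h3⟩
    exact ⟨⟨h1, sub_mem h3 h2⟩, h2⟩
  · rintro ⟨⟨h1, h3⟩, h2⟩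
    exact ⟨⟨h1, h2⟩, by simpa using add_mem h3 h2⟩

theorem exists_pyramid_basis (e : Module.Basis (Fin φ ⊕ Fin m) ℝ ((Fin n → ℝ) × ℝ)) :
    ∃ e' : Module.Basis (Fin φ ⊕ Fin (m + 1)) ℝ ((Fin (n + 1) → ℝ) × ℝ),
      (∀ z i, e'.repr z (Sum.inl i) = e.repr (apexProjection n z) (Sum.inl i)) ∧
      (∀ z (j : Fin m), e'.repr z (Sum.inr j.castSucc) =
        e.repr (apexProjection n z) (Sum.inr j)) ∧
      ∀ z, e'.repr z (Sum.inr (Fin.last m)) = z.1 (Fin.last n) := by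
  let f : (Fin (n + 1) → ℝ) × ℝ →ₗ[ℝ] (Fin φ ⊕ Fin (m + 1) → ℝ) :=
    LinearMap.pi (Sum.elim (fun i => e.coord (Sum.inl i) ∘ₗ apexProjection n)
      (Fin.snoc (α := fun _ => (Fin (n + 1) → ℝ) × ℝ →ₗ[ℝ] ℝ)
        (fun j => e.coord (Sum.inr j) ∘ₗ apexProjection n)
        (LinearMap.proj (Fin.last n) ∘ₗ LinearMap.fst ℝ _ _)))
  have hf1 : ∀ z i, f z (Sum.inl i) = e.repr (apexProjection n z) (Sum.inl i) := fun z i => rfl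
  have hf2 : ∀ z (j : Fin m), f z (Sum.inr j.castSucc) =
      e.repr (apexProjection n z) (Sum.inr j) := fun z j => by simp [f]
  have hf3 : ∀ z, f z (Sum.inr (Fin.last m)) = z.1 (Fin.last n) := fun z => by simp [f]
  have hinj : Function.Injective f := by
    rw [injective_iff_map_eq_zero]
    intro z hz
    have h1 : apexProjection n z = 0 := e.ext_elem fun i => by
      rw [map_zero, Finsupp.zero_apply]
      rcases i with i | j
      · rw [← hf1, hz]; rfl
      · rw [← hf2, hz]; rfl
    have h2 : z.1 (Fin.last n) = 0 := by rw [← hf3, hz]; rfl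
    obtain ⟨h3, h4⟩ := Prod.ext_iff.1 h1
    simp only [apexProjection, LinearMap.coe_mk, AddHom.coe_mk, h2, sub_zero] at h3 h4
    refine Prod.ext (funext fun i => ?_) h4
    refine Fin.lastCases h2 (fun j => congrFun h3 j) i
  have hrank : Module.finrank ℝ ((Fin (n + 1) → ℝ) × ℝ) =
      Module.finrank ℝ (Fin φ ⊕ Fin (m + 1) → ℝ) := by
    have := Module.finrank_eq_card_basis e
    simp at this ⊢
    omega
  refine ⟨Module.Basis.ofEquivFun (LinearEquiv.ofInjectiveOfFinrankEq f hinj hrank),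
    fun z i => ?_, fun z j => ?_, fun z => ?_⟩
  · rw [Module.Basis.ofEquivFun_repr_apply]; exact hf1 z i
  · rw [Module.Basis.ofEquivFun_repr_apply]; exact hf2 z j
  · rw [Module.Basis.ofEquivFun_repr_apply]; exact hf3 z

/-- The description of a lattice polytope `P` in `ℝ^n` by coordinates with respect to a basis of
its homogenization. The lattice is determined by a set `G` of values of the first `φ` coordinates,
the others being integral, and `P` is the convex hull of the last basis elements and of the points
whose first `φ` coordinates lie in `Y` and whose other coordinates vanish. -/
def HasDatum (G Y : Set (Fin φ → ℝ)) (n : ℕ) (P : Set (Fin n → ℝ)) : Prop :=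
  ∃ (m : ℕ) (e : Module.Basis (Fin φ ⊕ Fin m) ℝ ((Fin n → ℝ) × ℝ)) (V : Set (Fin n → ℝ)),
    (∀ i, (e i).2 = 1) ∧
    (∀ z, z ∈ homogeneousLattice n ↔
      (fun i => e.repr z (Sum.inl i)) ∈ G ∧ ∀ j, e.repr z (Sum.inr j) ∈ realIntegers) ∧
    P = convexHull ℝ V ∧
    ∀ v, v ∈ V ↔ (∃ j, (v, (1 : ℝ)) = e (Sum.inr j)) ∨
      ((∀ j, e.repr (v, (1 : ℝ)) (Sum.inr j) = 0) ∧
        (fun i => e.repr (v, (1 : ℝ)) (Sum.inl i)) ∈ Y)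

theorem latticePyramid_convexHull (V : Set (Fin n → ℝ)) :
    latticePyramid (convexHull ℝ V) = convexHull ℝ
      ((fun p => (Fin.snoc p (0 : ℝ) : Fin (n + 1) → ℝ)) '' V ∪ {Fin.snoc (0 : Fin n → ℝ) (1 : ℝ)}) := by
  let f : (Fin n → ℝ) →ₗ[ℝ] (Fin (n + 1) → ℝ) :=
    { toFun := fun p => Fin.snoc p 0
      map_add' := fun p q => by
        funext i
        refine Fin.lastCases ?_ (fun j => ?_) i <;> simp
      map_smul' := fun c p => by
        funext i
        refine Fin.lastCases ?_ (fun j => ?_) i <;> simp }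
  have h : (fun p => (Fin.snoc p (0 : ℝ) : Fin (n + 1) → ℝ)) = f := rfl
  rw [latticePyramid, h, f.image_convexHull, convexHull_convexHull_union_left]

theorem HasDatum.latticePyramid {G Y : Set (Fin φ → ℝ)} {P : Set (Fin n → ℝ)}
    (h : HasDatum G Y n P) : HasDatum G Y (n + 1) (latticePyramid P) := by
  obtain ⟨m, e, V, he, hM, rfl, hV⟩ := h
  obtain ⟨e', h1, h2, h3⟩ := exists_pyramid_basis e
  have hext : ∀ z w, apexProjection n z = apexProjection n w → z.1 (Fin.last n) = w.1 (Fin.last n) →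
      z = w := fun z w h h' => e'.ext_elem fun i => by
    rcases i with i | j
    · rw [h1, h1, h]
    · refine Fin.lastCases (by rw [h3, h3, h']) (fun j => by rw [h2, h2, h]) j
  have hproj : ∀ (p : Fin n → ℝ) (c t : ℝ),
      apexProjection n (Fin.snoc p c, t) = (p, t - c) := fun p c t => by
    simp [apexProjection]
  have hinl : ∀ i, e' (Sum.inl i) = (Fin.snoc (e (Sum.inl i)).1 0, (e (Sum.inl i)).2) := by
    intro i
    rw [Module.Basis.apply_eq_iff]
    ext j
    rcases j with j | j
    · rw [h1, hproj, sub_zero, Prod.mk.eta, e.repr_self]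
      simp [Finsupp.single_apply]
    · refine Fin.lastCases ?_ (fun j => ?_) j
      · rw [h3]; simp
      · rw [h2, hproj, sub_zero, Prod.mk.eta, e.repr_self]
        simp
  have hinr : ∀ j : Fin m, e' (Sum.inr j.castSucc) =
      (Fin.snoc (e (Sum.inr j)).1 0, (e (Sum.inr j)).2) := by
    intro i
    rw [Module.Basis.apply_eq_iff]
    ext j
    rcases j with j | j
    · rw [h1, hproj, sub_zero, Prod.mk.eta, e.repr_self]
      simp
    · refine Fin.lastCases ?_ (fun j => ?_) j
      · rw [h3]; simp [Fin.castSucc_ne_last]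
      · rw [h2, hproj, sub_zero, Prod.mk.eta, e.repr_self]
        simp [Finsupp.single_apply]
  have hlast : e' (Sum.inr (Fin.last m)) = (Fin.snoc 0 1, 1) := by
    rw [Module.Basis.apply_eq_iff]
    have h0 : apexProjection n (Fin.snoc 0 1, 1) = 0 := by rw [hproj, sub_self]; rfl
    ext j
    rcases j with j | j
    · rw [h1, h0]; simp
    · refine Fin.lastCases ?_ (fun j => ?_) j
      · rw [h3]; simp
      · rw [h2, h0]; simp
  refine ⟨m + 1, e', _, ?_, fun z => ?_, latticePyramid_convexHull V, fun v => ?_⟩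
  · rintro (i | j)
    · rw [hinl, he]
    · refine Fin.lastCases ?_ (fun j => ?_) j
      · rw [hlast]
      · rw [hinr, he]
  · rw [mem_homogeneousLattice_succ, hM, Fin.forall_fin_succ', and_assoc]
    simp only [h1, h2, h3]
  · rw [Set.mem_union, Set.mem_image, Set.mem_singleton_iff]
    constructor
    · rintro (⟨p, hp, rfl⟩ | rfl)
      · rcases (hV p).1 hp with ⟨j, hj⟩ | ⟨h4, h5⟩
        · left
          refine ⟨j.castSucc, ?_⟩
          rw [hinr, ← hj]
        · right
          simp only [h1, Fin.forall_fin_succ', h2, h3, hproj, sub_zero]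
          exact ⟨⟨h4, by simp⟩, h5⟩
      · exact Or.inl ⟨Fin.last m, hlast.symm⟩
    · rintro (⟨j, hj⟩ | ⟨h4, h5⟩)
      · induction j using Fin.lastCases with
        | last => exact Or.inr (Prod.ext_iff.1 (hj.trans hlast)).1
        | cast j =>
          rw [hinr] at hj
          refine Or.inl ⟨_, (hV _).2 (Or.inl ⟨j, ?_⟩), (Prod.ext_iff.1 hj).1.symm⟩
          exact Prod.ext rfl (he _).symm
      · left
        simp only [h1, Fin.forall_fin_succ', h2, h3] at h4 h5
        have h6 : (Fin.snoc (fun i => v i.castSucc) 0 : Fin (n + 1) → ℝ) = v := by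
          funext i
          refine Fin.lastCases ?_ (fun j => ?_) i
          · simp [h4.2]
          · simp
        have h7 : apexProjection n (v, 1) = (fun i => v i.castSucc, 1) := by
          rw [← h6, hproj]; simp
        rw [h7] at h4 h5
        exact ⟨_, (hV _).2 (Or.inr ⟨h4.1, h5⟩), h6⟩

theorem HasDatum.iterLatticePyramid {G Y : Set (Fin φ → ℝ)} {P : Set (Fin n → ℝ)}
    (h : HasDatum G Y n P) (r : ℕ) : HasDatum G Y (n + r) (iterLatticePyramid r P) := by
  induction r with
  | zero => exact h
  | succ r ih => exact ih.latticePyramid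

/-- The affine map induced on `ℝ^n × {1}` by a linear map. -/
def dehomogenize (T : (Fin n → ℝ) × ℝ →ₗ[ℝ] (Fin n → ℝ) × ℝ) :
    (Fin n → ℝ) →ᵃ[ℝ] (Fin n → ℝ) where
  toFun p := (T (p, 1)).1
  linear := LinearMap.fst ℝ _ _ ∘ₗ T ∘ₗ LinearMap.inl ℝ _ _
  map_vadd' p v := by
    have : ((v +ᵥ p, 1) : (Fin n → ℝ) × ℝ) = (v, 0) + (p, 1) := by simp
    rw [this, map_add]
    rfl

theorem HasDatum.unimodularlyEquivalent {G Y : Set (Fin φ → ℝ)} {P P' : Set (Fin n → ℝ)}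
    (h : HasDatum G Y n P) (h' : HasDatum G Y n P') : UnimodularlyEquivalent P P' := by
  obtain ⟨m, e, V, he, hM, rfl, hV⟩ := h
  obtain ⟨m', e', V', he', hM', rfl, hV'⟩ := h'
  obtain rfl : m = m' := by
    have h1 := Module.finrank_eq_card_basis e
    rw [Module.finrank_eq_card_basis e'] at h1
    simpa using h1.symm
  let T := e.equiv e' (Equiv.refl _)
  have hT : ∀ z i, e'.repr (T z) i = e.repr z i := fun z i => by
    simp [T, Module.Basis.equiv]
  have hTe : ∀ i, T (e i) = e' i := fun i => by simp [T]
  have hsnd : ∀ z, (T z).2 = z.2 := fun z => by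
    have : LinearMap.snd ℝ (Fin n → ℝ) ℝ ∘ₗ (T : _ →ₗ[ℝ] _) = LinearMap.snd ℝ (Fin n → ℝ) ℝ :=
      e.ext fun i => by
        simp only [LinearMap.comp_apply, LinearEquiv.coe_coe, hTe, LinearMap.snd_apply, he, he']
    exact LinearMap.congr_fun this z
  have hsnd' : ∀ z, (T.symm z).2 = z.2 := fun z => by
    rw [← hsnd, LinearEquiv.apply_symm_apply]
  have hmk : ∀ p, T (p, 1) = (dehomogenize (T : _ →ₗ[ℝ] _) p, 1) := fun p =>
    Prod.ext rfl (hsnd _)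
  have hmk' : ∀ p, T.symm (p, 1) = (dehomogenize (T.symm : _ →ₗ[ℝ] _) p, 1) := fun p =>
    Prod.ext rfl (hsnd' _)
  have hl : ∀ p, dehomogenize (T.symm : _ →ₗ[ℝ] _) (dehomogenize (T : _ →ₗ[ℝ] _) p) = p := fun p => by
    have h1 := hmk' (dehomogenize (T : _ →ₗ[ℝ] _) p)
    rw [← hmk, LinearEquiv.symm_apply_apply] at h1
    exact (Prod.ext_iff.1 h1).1.symm
  have hr : ∀ p, dehomogenize (T : _ →ₗ[ℝ] _) (dehomogenize (T.symm : _ →ₗ[ℝ] _) p) = p := fun p => by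
    have h1 := hmk (dehomogenize (T.symm : _ →ₗ[ℝ] _) p)
    rw [← hmk', LinearEquiv.apply_symm_apply] at h1
    exact (Prod.ext_iff.1 h1).1.symm
  have hbij : Function.Bijective (dehomogenize (n := n) (T : _ →ₗ[ℝ] _)) :=
    ⟨Function.LeftInverse.injective hl, Function.RightInverse.surjective hr⟩
  let τ : (Fin n → ℝ) ≃ᵃ[ℝ] (Fin n → ℝ) := AffineEquiv.ofBijective hbij
  have hτ : ∀ p, τ p = dehomogenize (T : _ →ₗ[ℝ] _) p := fun p => rfl
  have hVV' : ∀ v, τ v ∈ V' ↔ v ∈ V := fun v => by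
    rw [hV, hV', hτ, ← hmk]
    simp only [hT, ← hTe, EmbeddingLike.apply_eq_iff_eq]
  refine ⟨τ, fun u => ?_, ?_⟩
  · rw [isLatticePoint_iff_mem_homogeneousLattice, isLatticePoint_iff_mem_homogeneousLattice, hM,
      hM', hτ, ← hmk]
    simp only [hT]
  · have h1 : τ '' V = V' := by
      ext v
      constructor
      · rintro ⟨w, hw, rfl⟩
        exact (hVV' w).2 hw
      · intro hv
        refine ⟨τ.symm v, (hVV' _).1 ?_, τ.apply_symm_apply v⟩
        rwa [τ.apply_symm_apply]
    rw [← h1]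
    exact (τ : (Fin n → ℝ) →ᵃ[ℝ] (Fin n → ℝ)).image_convexHull V

end Datum

section Finiteness

variable {φ n D : ℕ}

/-- The vectors with coordinates in `D⁻¹ℤ` and prescribed residues. -/
def vectorsOfResidues (D : ℕ) (A : Set (Fin φ → ZMod D)) : Set (Fin φ → ℝ) :=
  {c | ∃ a : Fin φ → ℤ, (∀ i, D * c i = a i) ∧ (fun i => (a i : ZMod D)) ∈ A}

/-- The vectors with bounded coordinates in `D⁻¹ℤ` and prescribed numerators. -/
def vectorsOfNumerators (D : ℕ) (B : Set (Fin φ → Set.Icc (-(D * D) : ℤ) (D * D))) :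
    Set (Fin φ → ℝ) :=
  {c | ∃ a ∈ B, ∀ i, D * c i = ((a i : ℤ) : ℝ)}

theorem exists_hasDatum {κ : Type} [Fintype κ] {V : Finset (Fin n → ℝ)}
    (hVL : ∀ v ∈ V, IsLatticePoint v) (hD : 1 ≤ D)
    (b : Module.Basis κ ℝ ((Fin n → ℝ) × ℝ)) (F : Finset κ)
    (hb : ∀ i, b i ∈ homogeneousPoints V)
    (hF : ∀ i, i ∉ F → ∀ z ∈ homogeneousLattice n, b.repr z i ∈ realIntegers)
    (hFV : ∀ i, i ∉ F → ∀ w ∈ homogeneousPoints V, w ≠ b i → b.repr w i = 0)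
    (hDM : ∀ z ∈ homogeneousLattice n, ∀ i, D * b.repr z i ∈ realIntegers)
    (hDV : ∀ w ∈ homogeneousPoints V, ∀ i, |b.repr w i| ≤ D) :
    ∃ A B, HasDatum (φ := F.card) (vectorsOfResidues D A) (vectorsOfNumerators D B) n
      (convexHull ℝ (V : Set (Fin n → ℝ))) := by
  classical
  let σ : κ ≃ Fin F.card ⊕ Fin (Fintype.card {i // i ∉ F}) :=
    (Equiv.sumCompl (· ∈ F)).symm.trans
      (Equiv.sumCongr F.equivFin (Fintype.equivFin {i // i ∉ F}))
  have hσr : ∀ j, σ.symm (Sum.inr j) ∉ F := fun j => by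
    simpa [σ] using ((Fintype.equivFin {i // i ∉ F}).symm j).2
  let e := b.reindex σ
  have he : ∀ s, e s = b (σ.symm s) := fun s => b.reindex_apply σ s
  have her : ∀ z s, e.repr z s = b.repr z (σ.symm s) := fun z s => by
    simp [e]
  have hVM : ∀ w ∈ homogeneousPoints V, w ∈ homogeneousLattice n := fun w hw => by
    obtain ⟨v, hv, rfl⟩ := mem_homogeneousPoints.1 hw
    exact isLatticePoint_iff_mem_homogeneousLattice.1 (hVL v hv)
  have hmemV : ∀ v, (v, (1 : ℝ)) ∈ homogeneousPoints V ↔ v ∈ V := fun v => by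
    rw [mem_homogeneousPoints]
    refine ⟨?_, fun h => ⟨v, h, rfl⟩⟩
    rintro ⟨w, hw, h⟩
    obtain rfl : w = v := (Prod.ext_iff.1 h).1
    exact hw
  have hD0 : (D : ℝ) ≠ 0 := by exact_mod_cast (by omega : D ≠ 0)
  refine ⟨{r | ∃ z ∈ homogeneousLattice n, ∃ a : Fin F.card → ℤ,
      (∀ i, D * e.repr z (Sum.inl i) = a i) ∧ (fun i => (a i : ZMod D)) = r},
    {a | ∃ v ∈ V, (∀ j, e.repr (v, (1 : ℝ)) (Sum.inr j) = 0) ∧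
      ∀ i, D * e.repr (v, (1 : ℝ)) (Sum.inl i) = ((a i : ℤ) : ℝ)},
    _, e, V, fun s => ?_, fun z => ⟨fun hz => ?_, ?_⟩, rfl, fun v => ⟨fun hv => ?_, ?_⟩⟩
  · obtain ⟨v, -, hv⟩ := mem_homogeneousPoints.1 (hb (σ.symm s))
    rw [he, ← hv]
  · choose a ha using fun i => hDM z hz (σ.symm (Sum.inl i))
    have ha' : ∀ i, D * e.repr z (Sum.inl i) = a i := fun i => by
      rw [her, ← ha]
      rfl
    exact ⟨⟨a, ha', z, hz, a, ha', rfl⟩, fun j => by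
      rw [her]
      exact hF _ (hσr j) z hz⟩
  · rintro ⟨⟨a, ha, z', hz', a', ha', haa'⟩, hz⟩
    have hint : ∀ s, e.repr (z - z') s ∈ realIntegers := by
      intro s
      rw [map_sub, Finsupp.sub_apply]
      rcases s with i | j
      · obtain ⟨q, hq⟩ := (ZMod.intCast_eq_intCast_iff_dvd_sub _ _ _).1 (congrFun haa' i)
        refine ⟨q, ?_⟩
        have hq' : (a i : ℝ) - a' i = D * q := by exact_mod_cast hq
        rw [← ha, ← ha', ← mul_sub] at hq'
        exact (mul_left_cancel₀ hD0 hq').symm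
      · refine sub_mem (hz j) ?_
        rw [her]
        exact hF _ (hσr j) z' hz'
    choose q hq using hint
    have hsum : ∑ s, (q s : ℝ) • e s = z - z' := by
      conv_rhs => rw [← e.sum_repr (z - z')]
      exact Finset.sum_congr rfl fun s _ => by
        rw [← hq s]
        rfl
    have := sum_intCast_smul_mem (b := e) (M := homogeneousLattice n)
      (fun s => by rw [he]; exact hVM _ (hb _)) q
    rw [hsum] at this
    simpa using add_mem this hz'
  · have hv' := (hmemV v).2 hv
    by_cases hex : ∃ j, (v, (1 : ℝ)) = e (Sum.inr j)
    · exact Or.inl hex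
    push Not at hex
    have h0 : ∀ j, e.repr (v, (1 : ℝ)) (Sum.inr j) = 0 := fun j => by
      rw [her]
      exact hFV _ (hσr j) _ hv' (by rw [← he]; exact hex j)
    choose a ha using fun i => hDM _ (hVM _ hv') (σ.symm (Sum.inl i))
    have ha' : ∀ i, (a i : ℝ) = D * e.repr (v, (1 : ℝ)) (Sum.inl i) := fun i => by
      rw [her]
      exact ha i
    have hle : ∀ i, |a i| ≤ D * D := fun i => by
      have h1 : |(a i : ℝ)| ≤ D * D := by
        rw [ha', abs_mul, Nat.abs_cast, her]
        exact mul_le_mul_of_nonneg_left (hDV _ hv' _) (Nat.cast_nonneg _)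
      exact_mod_cast h1
    exact Or.inr ⟨h0, fun i => ⟨a i, abs_le.1 (hle i)⟩, ⟨v, hv, h0, fun i => (ha' i).symm⟩,
      fun i => (ha' i).symm⟩
  · rintro (⟨j, hj⟩ | ⟨h0, a, ⟨w, hw, h0', haw⟩, hav⟩)
    · rw [Finset.mem_coe, ← hmemV, hj, he]
      exact hb _
    · have : (v, (1 : ℝ)) = (w, 1) := e.ext_elem fun s => by
        rcases s with i | j
        · exact mul_left_cancel₀ hD0 ((hav i).trans (haw i).symm)
        · rw [h0, h0']
      obtain rfl : v = w := (Prod.ext_iff.1 this).1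
      exact hw

theorem HasDatum.unimodularlyEquivalent_reindexSet {n₀ r : ℕ} {G Y : Set (Fin φ → ℝ)}
    {P : Set (Fin n → ℝ)} {Q : Set (Fin n₀ → ℝ)} (hP : HasDatum G Y n P)
    (hQ : HasDatum G Y n₀ Q) (e : n₀ + r = n) :
    UnimodularlyEquivalent P (reindexSet e (_root_.iterLatticePyramid r Q)) := by
  subst e
  exact hP.unimodularlyEquivalent (hQ.iterLatticePyramid r)

theorem exists_finite_data (d k : ℕ) : ∃ (C : Type) (_ : Finite C) (ψ : C → ℕ)
    (G Y : (c : C) → Set (Fin (ψ c) → ℝ)), ∀ (n : ℕ) (P : Set (Fin n → ℝ)) (h : Polynomial ℤ),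
      IsLatticePolytope P → affineSpan ℝ P = ⊤ → IsHStarPoly P h → h.natDegree = d →
      h.coeff d = (k : ℤ) → ∃ c, HasDatum (G c) (Y c) n P := by
  obtain ⟨Φ, D, hD, hcore⟩ := exists_basis_with_apexes d k
  have : NeZero D := ⟨by omega⟩
  refine ⟨Σ f : Fin (Φ + 1), Set (Fin f → ZMod D) ×
      Set (Fin f → Set.Icc (-(D * D) : ℤ) (D * D)), inferInstance, fun c => c.1,
    fun c => vectorsOfResidues D c.2.1, fun c => vectorsOfNumerators D c.2.2, ?_⟩
  rintro n P h ⟨V, hV, hVL, rfl⟩ htop hh hd hk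
  obtain ⟨x, hx⟩ := exists_isMinimalInteriorPoint_homogeneousPoints hV hVL htop hh hd hk
  obtain ⟨κ, _, b, F, hb, hFΦ, hF, hFV, hDM, hDV⟩ := hcore hx
  obtain ⟨A, B, hdatum⟩ := exists_hasDatum hVL hD b F hb hF hFV hDM hDV
  exact ⟨⟨⟨F.card, by omega⟩, A, B⟩, hdatum⟩

end Finiteness

/-- Up to iterated lattice pyramids and unimodular equivalence, there
are only finitely many lattice polytopes whose `h^*`-polynomial has degree `d` and
leading coefficient `h^*_d = k`: there is a finite list `Q_1, …, Q_m` of lattice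
polytopes such that every such polytope is unimodularly equivalent to an iterated
lattice pyramid over some `Q_j`. -/
theorem statement15 (d k : ℕ) :
    ∃ (m : ℕ) (dims : Fin m → ℕ) (Q : (j : Fin m) → Set (Fin (dims j) → ℝ)),
      (∀ j, IsLatticePolytope (Q j)) ∧
      ∀ (n : ℕ) (P : Set (Fin n → ℝ)) (h : Polynomial ℤ),
        IsLatticePolytope P → affineSpan ℝ P = ⊤ →
        IsHStarPoly P h → h.natDegree = d → h.coeff d = (k : ℤ) →
        ∃ (j : Fin m) (r : ℕ) (e : dims j + r = n),
          UnimodularlyEquivalent P (reindexSet e (iterLatticePyramid r (Q j))) := by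
  classical
  obtain ⟨C, _, ψ, G, Y, hC⟩ := exists_finite_data d k
  let R : C → ℕ → Prop := fun c n => ∃ P, IsLatticePolytope P ∧ HasDatum (G c) (Y c) n P
  let ε := Finite.equivFin {c // ∃ n, R c n}
  let dims : {c // ∃ n, R c n} → ℕ := fun c => Nat.find c.2
  choose Q hQ hQd using fun c : {c // ∃ n, R c n} => Nat.find_spec c.2
  refine ⟨_, fun j => dims (ε.symm j), fun j => Q (ε.symm j), fun j => hQ _, ?_⟩
  intro n P h hP htop hh hd hk
  obtain ⟨c, hc⟩ := hC n P h hP htop hh hd hk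
  let c' : {c // ∃ n, R c n} := ⟨c, n, P, hP, hc⟩
  have hle : dims c' ≤ n := Nat.find_min' _ ⟨P, hP, hc⟩
  obtain ⟨j, hj⟩ : ∃ j, ε.symm j = c' := ⟨ε c', ε.symm_apply_apply c'⟩
  have hle' : dims (ε.symm j) ≤ n := hj.symm ▸ hle
  have hc' : HasDatum (G (ε.symm j).1) (Y (ε.symm j).1) n P := hj.symm ▸ hc
  exact ⟨j, _, Nat.add_sub_of_le hle', hc'.unimodularlyEquivalent_reindexSet (hQd _) _⟩

end
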